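/- Let ⟨S | R⟩ be a classical C'(1/6) presentation with group G, let α be a geodesic in Cay(G,S), and let Γ0 be an embedded relator cycle with Γ0 ∩ α ≠ ∅. Then closest point projection of Γ0 to α agrees with closest point projection of Γ0 to Γ0 ∩ α: for every x ∈ Γ0, d_S(x, α) = d_S(x, Γ0 ∩ α) and {y ∈ α : d_S(x,y) = d_S(x,α)} = {y ∈ Γ0 ∩ α : d_S(x,y) = d_S(x, Γ0 ∩ α)}. -/

import Mathlib

/- Common definitions: words, classical C'(1/6) presentations, word metrics,
   contraction, Morse property, etc. -/

namespace GSC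

open Filter

/-- A word over the alphabet `S`: a list of letters with an exponent `±1`
(`true` = the letter, `false` = its formal inverse). -/
abbrev Word (S : Type) := List (S × Bool)

/-- The formal inverse of a word. -/
def wordInv {S : Type} (w : Word S) : Word S := (w.map fun l => (l.1, !l.2)).reverse

/-- A word is (freely) reduced if no letter is followed by its formal inverse. -/
def Reduced {S : Type} (w : Word S) : Prop :=
  List.Chain' (fun a b => a.1 ≠ b.1 ∨ a.2 = b.2) w

/-- A word is cyclically reduced if its square is reduced. -/
def CyclicallyReduced {S : Type} (w : Word S) : Prop := Reduced (w ++ w)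

/-- A piece with respect to a set of relators `R`: a word occurring as a prefix of
two distinct elements of `R`. -/
def IsPiece {S : Type} (R : Set (Word S)) (p : Word S) : Prop :=
  ∃ r₁ ∈ R, ∃ r₂ ∈ R, r₁ ≠ r₂ ∧ p <+: r₁ ∧ p <+: r₂

/-- Closure of a set of words under inversion and cyclic permutation. -/
def symmClosure {S : Type} (R : Set (Word S)) : Set (Word S) :=
  {w | ∃ r ∈ R, ∃ n : ℕ, w = r.rotate n ∨ w = wordInv (r.rotate n)}

/-- A classical `C'(1/den)` collection of cyclically reduced words: after closing under
inversion and cyclic permutation, every piece `p` contained in a relator `r` satisfies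
`den * |p| < |r|`. -/
def CprimeCollection {S : Type} (den : ℕ) (R : Set (Word S)) : Prop :=
  (∀ r ∈ R, CyclicallyReduced r) ∧
  ∀ r ∈ symmClosure R, ∀ p : Word S, p <+: r → IsPiece (symmClosure R) p →
    den * p.length < r.length

/-- A classical `C'(1/6)` presentation: a set of cyclically reduced relators, closed under
inversion and cyclic permutation, in which every piece contained in a relator `r` has
length `< |r|/6`. -/
structure C6Presentation (S : Type) where
  rels : Set (Word S)
  cyclically_reduced : ∀ r ∈ rels, CyclicallyReduced r
  inv_mem : ∀ r ∈ rels, wordInv r ∈ rels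
  rotate_mem : ∀ r ∈ rels, ∀ n : ℕ, r.rotate n ∈ rels
  small_cancellation : ∀ r ∈ rels, ∀ p : Word S, p <+: r → IsPiece rels p →
    6 * p.length < r.length

/-- The element of the free group represented by a word. -/
def wordVal {S : Type} (w : Word S) : FreeGroup S :=
  (w.map fun l => (FreeGroup.of l.1) ^ (if l.2 then (1 : ℤ) else -1)).prod

/-- The group defined by a `C'(1/6)` presentation. -/
abbrev C6Presentation.Grp {S : Type} (P : C6Presentation S) : Type :=
  PresentedGroup (wordVal '' P.rels)

/-- The generating set of the presented group (the images of the letters of `S`). -/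
def C6Presentation.gens {S : Type} (P : C6Presentation S) : Set P.Grp :=
  Set.range fun a : S => (PresentedGroup.of a : P.Grp)

/-- The element of the presented group represented by a word. -/
def C6Presentation.elt {S : Type} (P : C6Presentation S) (w : Word S) : P.Grp :=
  (w.map fun l => (PresentedGroup.of l.1 : P.Grp) ^ (if l.2 then (1 : ℤ) else -1)).prod

/-- The word length of `g` with respect to a generating set `S ⊆ G`: the least `n`
such that `g` is a product of `n` elements of `S ∪ S⁻¹`. -/
noncomputable def wordLength {G : Type*} [Group G] (S : Set G) (g : G) : ℕ :=
  sInf {n : ℕ | ∃ l : List G, l.length = n ∧ (∀ x ∈ l, x ∈ S ∨ x⁻¹ ∈ S) ∧ l.prod = g}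

/-- The word metric on `G` with respect to `S`, as a real-valued function. -/
noncomputable def wdist {G : Type*} [Group G] (S : Set G) (g h : G) : ℝ :=
  (wordLength S (g⁻¹ * h) : ℝ)

/-- Distance from a point to a subset, in the word metric. -/
noncomputable def setDist {G : Type*} [Group G] (S : Set G) (x : G) (Y : Set G) : ℝ :=
  sInf (wdist S x '' Y)

/-- Closest point projection to a subset `Y`, in the word metric. -/
def proj {G : Type*} [Group G] (S : Set G) (Y : Set G) (x : G) : Set G :=
  {y ∈ Y | wdist S x y = setDist S x Y}

/-- Diameter of a subset, in the word metric. -/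
noncomputable def setDiam {G : Type*} [Group G] (S : Set G) (A : Set G) : ℝ :=
  sSup {d : ℝ | ∃ x ∈ A, ∃ y ∈ A, d = wdist S x y}

/-- Admissibility of a pair of contraction gauges `(ρ₁, ρ₂)`: both non-decreasing and
eventually non-negative, `ρ₁ r ≤ r`, `ρ₁` unbounded, and `ρ₂/ρ₁ → 0` at infinity. -/
def Admissible (ρ₁ ρ₂ : ℝ → ℝ) : Prop :=
  Monotone ρ₁ ∧ Monotone ρ₂ ∧
  (∀ᶠ r in atTop, 0 ≤ ρ₁ r) ∧ (∀ᶠ r in atTop, 0 ≤ ρ₂ r) ∧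
  (∀ r : ℝ, ρ₁ r ≤ r) ∧ (∀ M : ℝ, ∃ r : ℝ, M ≤ ρ₁ r) ∧
  Tendsto (fun r => ρ₂ r / ρ₁ r) atTop (nhds 0)

/-- `Y` is `(ρ₁,ρ₂)`-contracting inside the subspace `X` (with the metric induced by the
word metric of `S`): whenever `x, x' ∈ X` satisfy `d(x,x') ≤ ρ₁(d(x,Y))`, the projections
`π(x) ∪ π(x')` have diameter at most `ρ₂(d(x,Y))`. -/
def ContractingIn {G : Type*} [Group G] (S : Set G) (X Y : Set G) (ρ₁ ρ₂ : ℝ → ℝ) : Prop :=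
  Admissible ρ₁ ρ₂ ∧
  ∀ x ∈ X, ∀ x' ∈ X, wdist S x x' ≤ ρ₁ (setDist S x Y) →
    ∀ y ∈ proj S Y x ∪ proj S Y x', ∀ y' ∈ proj S Y x ∪ proj S Y x',
      wdist S y y' ≤ ρ₂ (setDist S x Y)

/-- `Y` is `(ρ₁,ρ₂)`-contracting in `Cay(G,S)`. -/
def ContractingWith {G : Type*} [Group G] (S : Set G) (ρ₁ ρ₂ : ℝ → ℝ) (Y : Set G) : Prop :=
  ContractingIn S Set.univ Y ρ₁ ρ₂

/-- `Y` is strongly contracting: `(r, C)`-contracting for some constant `C`. -/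
def StronglyContracting {G : Type*} [Group G] (S : Set G) (Y : Set G) : Prop :=
  ∃ C : ℝ, ContractingWith S (fun r => r) (fun _ => C) Y

/-- A sublinear function: non-decreasing, eventually non-negative, `f(r)/r → 0`. -/
def Sublinear (f : ℝ → ℝ) : Prop :=
  Monotone f ∧ (∀ᶠ r in atTop, 0 ≤ f r) ∧ Tendsto (fun r => f r / r) atTop (nhds 0)

/-- `f ⪯ g`: there are constants `C₁, C₂ > 0` and `C₃, C₄ ≥ 0` with
`f(x) ≤ C₁ g(C₂ x + C₃) + C₄` for all `x`. -/
def Preceq (f g : ℝ → ℝ) : Prop :=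
  ∃ C₁ C₂ C₃ C₄ : ℝ, 0 < C₁ ∧ 0 < C₂ ∧ 0 ≤ C₃ ∧ 0 ≤ C₄ ∧
    ∀ x : ℝ, f x ≤ C₁ * g (C₂ * x + C₃) + C₄

/-- `f ≍ g`: `f ⪯ g` and `g ⪯ f`. -/
def Asymp (f g : ℝ → ℝ) : Prop := Preceq f g ∧ Preceq g f

/-- `α ⊆ G` is a geodesic of `Cay(G,S)`: the image of an isometric embedding of a
subinterval of `ℤ` into `(G, d_S)`. -/
def IsGeodesic {G : Type*} [Group G] (S : Set G) (α : Set G) : Prop :=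
  ∃ (I : Set ℤ) (γ : ℤ → G), I.OrdConnected ∧
    (∀ m ∈ I, ∀ n ∈ I, wdist S (γ m) (γ n) = |(m : ℝ) - (n : ℝ)|) ∧ α = γ '' I

/-- `α ⊆ G` is a bi-infinite geodesic of `Cay(G,S)`. -/
def IsBiInfGeodesic {G : Type*} [Group G] (S : Set G) (α : Set G) : Prop :=
  ∃ γ : ℤ → G, (∀ m n : ℤ, wdist S (γ m) (γ n) = |(m : ℝ) - (n : ℝ)|) ∧ α = Set.range γ

/-- `Y` is Morse: there is `μ` such that every `(L,A)`-quasi-geodesic with endpoints on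
`Y` stays in the `μ(L,A)`-neighborhood of `Y`. -/
def IsMorse {G : Type*} [Group G] (S : Set G) (Y : Set G) : Prop :=
  ∃ μ : ℝ → ℝ → ℝ, ∀ L A : ℝ, 1 ≤ L → 0 ≤ A →
    ∀ (q : ℤ → G) (m n : ℤ), m ≤ n → q m ∈ Y → q n ∈ Y →
    (∀ i j : ℤ, m ≤ i → i ≤ n → m ≤ j → j ≤ n →
      L⁻¹ * |(i : ℝ) - (j : ℝ)| - A ≤ wdist S (q i) (q j) ∧
      wdist S (q i) (q j) ≤ L * |(i : ℝ) - (j : ℝ)| + A) →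
    ∀ i : ℤ, m ≤ i → i ≤ n → setDist S (q i) Y ≤ μ L A

/-- Two subsets are at finite Hausdorff distance in the word metric. -/
def FinHausdorffDist {G : Type*} [Group G] (S : Set G) (A B : Set G) : Prop :=
  ∃ ε : ℝ, (∀ a ∈ A, ∃ b ∈ B, wdist S a b ≤ ε) ∧ ∀ b ∈ B, ∃ a ∈ A, wdist S a b ≤ ε

/-- The embedded relator cycle determined by `g ∈ G(Γ)` and a relator `r`:
the set `{g ⋅ p̄ : p a prefix of r}`. -/
def relatorCycle {S : Type} (P : C6Presentation S) (g : P.Grp) (r : Word S) :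
    Set P.Grp :=
  {x | ∃ p : Word S, p <+: r ∧ x = g * P.elt p}

/-- A geodesic `α` is locally `(ρ₁,ρ₂)`-contracting: for every embedded relator cycle
`Γ₀` meeting `α`, the set `Γ₀ ∩ α` is `(ρ₁,ρ₂)`-contracting as a subspace of `Γ₀`. -/
def LocallyContracting {S : Type} (P : C6Presentation S) (α : Set P.Grp)
    (ρ₁ ρ₂ : ℝ → ℝ) : Prop :=
  ∀ (g : P.Grp) (r : Word S), r ∈ P.rels → (relatorCycle P g r ∩ α).Nonempty →
    ContractingIn P.gens (relatorCycle P g r) (relatorCycle P g r ∩ α) ρ₁ ρ₂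

/-- The generating set `S ∪ W` of the coned-off space: `W` is the set of elements
represented by subwords of cyclic permutations of relators (equivalently, by prefixes
of relators, since the relator set is closed under cyclic permutation). -/
def conedGens {S : Type} (P : C6Presentation S) : Set P.Grp :=
  P.gens ∪ {x | ∃ r ∈ P.rels, ∃ p : Word S, p <+: r ∧ x = P.elt p}

/-- The exponential growth rate of `(G,S)`. -/
noncomputable def growthRate {G : Type*} [Group G] (S : Set G) : ℝ :=
  limsup (fun n : ℕ => Real.log (Nat.card {g : G // wordLength S g ≤ n}) / (n : ℝ)) atTop

/-- Quasi-isometry of marked groups `(G,S)` and `(H,T)` via word metrics. -/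
def QIsom {G H : Type*} [Group G] [Group H] (S : Set G) (T : Set H) : Prop :=
  ∃ (f : G → H) (L A : ℝ), 1 ≤ L ∧ 0 ≤ A ∧
    (∀ x y : G, L⁻¹ * wdist S x y - A ≤ wdist T (f x) (f y) ∧
      wdist T (f x) (f y) ≤ L * wdist S x y + A) ∧
    ∀ h : H, ∃ x : G, wdist T (f x) h ≤ A

/-- A subgroup is virtually cyclic if it contains a cyclic subgroup of finite index. -/
def VirtuallyCyclic {G : Type*} [Group G] (E : Subgroup G) : Prop :=
  ∃ g : G, Subgroup.zpowers g ≤ E ∧ ((Subgroup.zpowers g).subgroupOf E).index ≠ 0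

end GSC

namespace GSC

open Function

variable {S : Type}

/-! ### Words and the elements they represent -/

/-- The formal inverse of a letter. -/
def letterInv (a : S × Bool) : S × Bool := (a.1, !a.2)

/-- The element of the presented group represented by a letter. -/
def C6Presentation.letter (P : C6Presentation S) (a : S × Bool) : P.Grp :=
  (PresentedGroup.of a.1 : P.Grp) ^ (if a.2 then (1 : ℤ) else -1)

@[simp]
theorem letterInv_letterInv (a : S × Bool) : letterInv (letterInv a) = a := by
  simp [letterInv]

theorem letterInv_ne (a : S × Bool) : letterInv a ≠ a := by
  rcases a with ⟨a, _ | _⟩ <;> simp [letterInv]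

theorem ne_letterInv_iff {a b : S × Bool} : b ≠ letterInv a ↔ (a.1 ≠ b.1 ∨ a.2 = b.2) := by
  rcases a with ⟨a, i⟩
  rcases b with ⟨b, j⟩
  cases i <;> cases j <;> simp [letterInv, eq_comm]

@[simp]
theorem letter_letterInv (P : C6Presentation S) (a : S × Bool) :
    P.letter (letterInv a) = (P.letter a)⁻¹ := by
  rcases a with ⟨a, _ | _⟩ <;> simp [letterInv, C6Presentation.letter]

@[simp]
theorem elt_nil (P : C6Presentation S) : P.elt [] = 1 := rfl

@[simp]
theorem elt_cons (P : C6Presentation S) (a : S × Bool) (w : Word S) :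
    P.elt (a :: w) = P.letter a * P.elt w := by
  simp [C6Presentation.elt, C6Presentation.letter]

@[simp]
theorem elt_append (P : C6Presentation S) (u v : Word S) :
    P.elt (u ++ v) = P.elt u * P.elt v := by
  simp [C6Presentation.elt]

theorem wordInv_eq (w : Word S) : wordInv w = (w.map letterInv).reverse := rfl

@[simp]
theorem length_wordInv (w : Word S) : (wordInv w).length = w.length := by
  simp [wordInv]

@[simp]
theorem wordInv_append (u v : Word S) : wordInv (u ++ v) = wordInv v ++ wordInv u := by
  simp [wordInv]

@[simp]
theorem wordInv_wordInv (w : Word S) : wordInv (wordInv w) = w :=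
  FreeGroup.invRev_invRev

theorem wordInv_singleton (a : S × Bool) : wordInv [a] = [letterInv a] := rfl

theorem elt_wordInv (P : C6Presentation S) (w : Word S) : P.elt (wordInv w) = (P.elt w)⁻¹ := by
  induction w with
  | nil => simp [wordInv]
  | cons a w ih =>
    rw [← List.singleton_append, wordInv_append, elt_append, ih, wordInv_singleton]
    simp

theorem wordVal_eq_mk (w : Word S) : wordVal w = FreeGroup.mk w := by
  induction w with
  | nil => rfl
  | cons a w ih =>
    have h : wordVal (a :: w) = FreeGroup.of a.1 ^ (if a.2 then (1 : ℤ) else -1) * wordVal w := by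
      simp [wordVal]
    rw [h, ih]
    rcases a with ⟨a, _ | _⟩ <;> simp [FreeGroup.of, FreeGroup.inv_mk, FreeGroup.invRev]

theorem elt_eq_mk (P : C6Presentation S) (w : Word S) :
    P.elt w = PresentedGroup.mk (wordVal '' P.rels) (wordVal w) := by
  simp only [C6Presentation.elt, wordVal, map_list_prod, List.map_map]
  congr 2

theorem elt_eq_one_iff (P : C6Presentation S) (w : Word S) :
    P.elt w = 1 ↔ wordVal w ∈ Subgroup.normalClosure (wordVal '' P.rels) := by
  rw [elt_eq_mk]
  exact QuotientGroup.eq_one_iff _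

theorem elt_of_mem_rels (P : C6Presentation S) {r : Word S} (hr : r ∈ P.rels) : P.elt r = 1 :=
  (elt_eq_one_iff P r).2 (Subgroup.subset_normalClosure ⟨r, hr, rfl⟩)

theorem red_nil_of_wordVal_eq_one {w : Word S} (h : wordVal w = 1) : FreeGroup.Red w [] := by
  rw [wordVal_eq_mk, FreeGroup.one_eq_mk] at h
  obtain ⟨c, h₁, h₂⟩ := FreeGroup.Red.exact.1 h
  rwa [FreeGroup.Red.nil_iff.1 h₂] at h₁

/-- Every element of the normal closure of the relators is a product of conjugates of relators. -/
theorem exists_conjugates (P : C6Presentation S) {x : FreeGroup S}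
    (hx : x ∈ Subgroup.normalClosure (wordVal '' P.rels)) :
    ∃ l : List (Word S × Word S), (∀ c ∈ l, c.2 ∈ P.rels) ∧
      x = wordVal (l.flatMap fun c => c.1 ++ c.2 ++ wordInv c.1) := by
  have key : ∀ c : Word S × Word S, wordInv (c.1 ++ c.2 ++ wordInv c.1) =
      c.1 ++ wordInv c.2 ++ wordInv c.1 := fun c => by simp
  have mk_inv : ∀ w : Word S, (wordVal w)⁻¹ = wordVal (wordInv w) := fun w => by
    simp only [wordVal_eq_mk, FreeGroup.inv_mk]; rfl
  have mk_mul : ∀ u v : Word S, wordVal u * wordVal v = wordVal (u ++ v) := fun u v => by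
    simp only [wordVal_eq_mk, FreeGroup.mul_mk]
  induction hx using Subgroup.closure_induction with
  | mem x hx =>
    classical
    obtain ⟨_, ⟨r, hr, rfl⟩, hc⟩ := Group.mem_conjugatesOfSet_iff.1 hx
    obtain ⟨g, rfl⟩ := isConj_iff.1 hc
    refine ⟨[(g.toWord, r)], by simpa using hr, ?_⟩
    have hg : g = wordVal g.toWord := by rw [wordVal_eq_mk, FreeGroup.mk_toWord]
    simp only [List.flatMap_cons, List.flatMap_nil, List.append_nil, ← mk_mul, ← mk_inv, ← hg]
  | one => exact ⟨[], by simp, rfl⟩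
  | mul x y _ _ ihx ihy =>
    obtain ⟨l, hl, rfl⟩ := ihx
    obtain ⟨m, hm, rfl⟩ := ihy
    exact ⟨l ++ m, fun c hc => (List.mem_append.1 hc).elim (hl c) (hm c), by
      rw [mk_mul, List.flatMap_append]⟩
  | inv x hx ih =>
    obtain ⟨l, hl, rfl⟩ := ih
    refine ⟨(l.map fun c => (c.1, wordInv c.2)).reverse, ?_, ?_⟩
    · intro c hc
      simp only [List.mem_reverse, List.mem_map] at hc
      obtain ⟨c, hc, rfl⟩ := hc
      exact P.inv_mem _ (hl c hc)
    · rw [mk_inv]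
      congr 1
      clear hl hx
      induction l with
      | nil => rfl
      | cons c l ih =>
        rw [List.flatMap_cons, wordInv_append, ih, key]
        simp [List.flatMap_append]

end GSC


namespace GSC

open Function

variable {S : Type}

/-! ### Face words -/

/-- The word read along the orbit of `d` under `f`. -/
noncomputable def faceWord {D : Type} (f : D → D) (lab : D → S × Bool) (d : D) : Word S :=
  (List.range (minimalPeriod f d)).map fun k => lab (f^[k] d)

@[simp]
theorem length_faceWord {D : Type} (f : D → D) (lab : D → S × Bool) (d : D) :
    (faceWord f lab d).length = minimalPeriod f d := by
  simp [faceWord]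

theorem getElem_faceWord {D : Type} (f : D → D) (lab : D → S × Bool) (d : D) (k : ℕ)
    (hk : k < (faceWord f lab d).length) : (faceWord f lab d)[k] = lab (f^[k] d) := by
  simp [faceWord]

theorem faceWord_congr {D D' : Type} {f : D → D} {f' : D' → D'} {lab : D → S × Bool}
    {lab' : D' → S × Bool} {d : D} {φ : D → D'} (hφ : Injective φ)
    (hf : ∀ k, f'^[k] (φ d) = φ (f^[k] d)) (hlab : ∀ k, lab' (φ (f^[k] d)) = lab (f^[k] d)) :
    faceWord f' lab' (φ d) = faceWord f lab d := by
  have hper : minimalPeriod f' (φ d) = minimalPeriod f d := by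
    rw [minimalPeriod_eq_minimalPeriod_iff]
    intro n
    rw [IsPeriodicPt, IsFixedPt, hf, hφ.eq_iff]
    rfl
  simp only [faceWord, hper, hf, hlab]

theorem minimalPeriod_pos {D : Type} [Finite D] {f : D → D} (hf : Injective f) (d : D) :
    0 < minimalPeriod f d :=
  minimalPeriod_pos_of_mem_periodicPts (hf.mem_periodicPts d)

theorem faceWord_iterate {D : Type} [Finite D] {f : D → D} (hf : Injective f)
    (lab : D → S × Bool) (d : D) (k : ℕ) :
    faceWord f lab (f^[k] d) = (faceWord f lab d).rotate k := by
  have hp := minimalPeriod_apply_iterate (hf.mem_periodicPts d) k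
  refine List.ext_getElem (by simp [hp]) fun m h₁ h₂ => ?_
  rw [List.getElem_rotate, getElem_faceWord, getElem_faceWord, length_faceWord,
    iterate_mod_minimalPeriod_eq, iterate_add_apply]

end GSC


namespace GSC

open Function

variable {S : Type}

/-! ### Planar diagrams

A diagram is a combinatorial map: a finite set `D` of darts, with an involution `e` reversing darts
and a permutation `f` whose orbits are the boundary cycles of the faces. The dart following `d` in
the cyclic order at its initial vertex is `f (e d)`. Planarity is expressed homologically: every
antisymmetric function on darts which integrates to zero around faces is the differential of a
function on vertices. -/

/-- `StepChain st en l s t` says that the intervals `[st a, en a]`, for `a ∈ l`, fit together to a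
chain from `s` to `t`. -/
def StepChain {D X : Type} (st en : D → X) : List D → X → X → Prop
  | [], s, t => s = t
  | a :: l, s, t => st a = s ∧ StepChain st en l (en a) t

theorem stepChain_append {D X : Type} (st en : D → X) (u v : List D) (s t : X) :
    StepChain st en (u ++ v) s t ↔ ∃ m, StepChain st en u s m ∧ StepChain st en v m t := by
  induction u generalizing s with
  | nil => simp [StepChain]
  | cons a u ih => simp [StepChain, ih, and_assoc]

theorem stepChain_congr {D D' X : Type} {st en : D → X} {st' en' : D' → X} {φ : D → D'}
    {l : List D} (h₁ : ∀ a ∈ l, st' (φ a) = st a) (h₂ : ∀ a ∈ l, en' (φ a) = en a) (s t : X) :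
    StepChain st' en' (l.map φ) s t ↔ StepChain st en l s t := by
  induction l generalizing s with
  | nil => simp [StepChain]
  | cons a l ih =>
    simp only [List.map_cons, StepChain, h₁ a (by simp), h₂ a (by simp)]
    rw [ih (fun b hb => h₁ b (by simp [hb])) (fun b hb => h₂ b (by simp [hb]))]

/-- A function of the initial vertex of a dart, in a partially glued diagram whose unglued darts
are listed in `L` in their cyclic order along the boundary. -/
def IsVertexFun {D X : Type} (e f : D → D) (L : List D) (p : D → X) : Prop :=
  (∀ d, d ∉ L → p (e d) = p (f d)) ∧ ∃ s, StepChain p (fun d => p (f d)) L s s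

/-- A face all of whose edges are exposed or inner, of the three kinds allowed in a diagram:
the base face, a relator, or a digon. -/
def IsFace (P : C6Presentation S) {D : Type} (f : D → D) (lab : D → S × Bool) (base d : D) : Prop :=
  (∃ k, f^[k] base = d) ∨ faceWord f lab d ∈ P.rels ∨ (f (f d) = d ∧ lab (f d) = letterInv (lab d))

/-- A partially glued planar diagram over `P` with base face labelled `W`. -/
structure OpenDiagram (P : C6Presentation S) (W : Word S) where
  D : Type
  [fin : Fintype D]
  e : D → D
  f : Equiv.Perm D
  lab : D → S × Bool
  pos : D → P.Grp
  bdry : List D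
  base : D
  nodup : bdry.Nodup
  e_notMem : ∀ d, d ∉ bdry → e d ∉ bdry
  e_e : ∀ d, d ∉ bdry → e (e d) = d
  e_ne : ∀ d, d ∉ bdry → e d ≠ d
  lab_e : ∀ d, d ∉ bdry → lab (e d) = letterInv (lab d)
  pos_f : ∀ d, pos (f d) = pos d * P.letter (lab d)
  pos_vertex : IsVertexFun e f bdry pos
  base_word : faceWord f lab base = W
  face : ∀ d, IsFace P f lab base d
  exact : ∀ q : D → ℚ, (∀ d, d ∉ bdry → q (f (e d)) - q (e d) = -(q (f d) - q d)) →
    ∃ c : D → ℚ, (∀ d, c (f d) = c d) ∧ IsVertexFun e f bdry (fun d => q d + c d)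

attribute [instance] OpenDiagram.fin

/-- A planar diagram over `P` with base face labelled `W`. -/
structure Diagram (P : C6Presentation S) (W : Word S) where
  D : Type
  [fin : Fintype D]
  e : D → D
  f : Equiv.Perm D
  lab : D → S × Bool
  pos : D → P.Grp
  base : D
  e_e : ∀ d, e (e d) = d
  e_ne : ∀ d, e d ≠ d
  lab_e : ∀ d, lab (e d) = letterInv (lab d)
  pos_f : ∀ d, pos (f d) = pos d * P.letter (lab d)
  pos_e : ∀ d, pos (e d) = pos d * P.letter (lab d)
  base_word : faceWord f lab base = W
  face : ∀ d, IsFace P f lab base d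
  exact : ∀ q : D → ℚ, (∀ d, q (f (e d)) - q (e d) = -(q (f d) - q d)) →
    ∃ c : D → ℚ, (∀ d, c (f d) = c d) ∧ ∀ d, q (e d) + c (e d) = q (f d) + c (f d)

attribute [instance] Diagram.fin

/-- An open diagram without boundary is a diagram. -/
def OpenDiagram.toDiagram {P : C6Presentation S} {W : Word S} (M : OpenDiagram P W)
    (h : M.bdry = []) : Diagram P W where
  D := M.D
  e := M.e
  f := M.f
  lab := M.lab
  pos := M.pos
  base := M.base
  e_e d := M.e_e d (by simp [h])
  e_ne d := M.e_ne d (by simp [h])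
  lab_e d := M.lab_e d (by simp [h])
  pos_f := M.pos_f
  pos_e d := by rw [M.pos_vertex.1 d (by simp [h]), M.pos_f]
  base_word := M.base_word
  face := M.face
  exact q hq := by
    obtain ⟨c, h₁, h₂⟩ := M.exact q fun d _ => hq d
    exact ⟨c, h₁, fun d => h₂.1 d (by simp [h])⟩

/-! #### A single polygon -/

/-- The labelling of the `n`-gon by the letters of `w`. -/
def polygonLab (w : Word S) (n : ℕ) (h : n = w.length) [NeZero n] (z : ZMod n) : S × Bool :=
  w[z.val]'(h ▸ z.val_lt)

/-- The rotation of the `n`-gon. -/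
def polygonRot (n : ℕ) : Equiv.Perm (ZMod n) := Equiv.addRight 1

theorem polygonRot_iterate (n k : ℕ) (z : ZMod n) : (polygonRot n)^[k] z = z + k := by
  induction k with
  | zero => simp
  | succ k ih => rw [iterate_succ_apply', ih]; simp [polygonRot, add_assoc]

theorem minimalPeriod_polygonRot (n : ℕ) (z : ZMod n) : minimalPeriod (polygonRot n) z = n := by
  refine Nat.dvd_antisymm ?_ ?_
  · rw [← isPeriodicPt_iff_minimalPeriod_dvd, IsPeriodicPt, IsFixedPt, polygonRot_iterate]
    simp
  · have := iterate_minimalPeriod (f := polygonRot n) (x := z)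
    rw [polygonRot_iterate] at this
    rwa [← CharP.cast_eq_zero_iff (ZMod n), ← add_eq_left (a := z)]

theorem faceWord_polygon (w : Word S) (n : ℕ) (h : n = w.length) [NeZero n] :
    faceWord (polygonRot n) (polygonLab w n h) 0 = w := by
  refine List.ext_getElem (by simp [minimalPeriod_polygonRot, h]) fun k h₁ h₂ => ?_
  rw [getElem_faceWord, polygonRot_iterate]
  simp [polygonLab, ZMod.val_natCast, Nat.mod_eq_of_lt (h ▸ h₂ : k < n)]

/-- The position of the initial vertex of a dart of the `n`-gon labelled `w`. -/
def polygonPos (P : C6Presentation S) (w : Word S) (n : ℕ) (g : P.Grp) (z : ZMod n) : P.Grp :=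
  g * P.elt (w.take z.val)

theorem elt_take_succ (P : C6Presentation S) (w : Word S) (k : ℕ) (hk : k < w.length) :
    P.elt (w.take (k + 1)) = P.elt (w.take k) * P.letter w[k] := by
  rw [List.take_succ_eq_append_getElem hk, elt_append]
  simp

theorem polygonPos_rot (P : C6Presentation S) (w : Word S) (n : ℕ) (h : n = w.length) [NeZero n]
    (g : P.Grp) (hw : P.elt w = 1) (z : ZMod n) :
    polygonPos P w n g (polygonRot n z) =
      polygonPos P w n g z * P.letter (polygonLab w n h z) := by
  have hz : z.val < w.length := h ▸ z.val_lt
  rw [polygonPos, polygonPos, polygonLab, mul_assoc, ← elt_take_succ P w _ hz]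
  congr 1
  have hv : (polygonRot n z).val = (z.val + 1) % n := by
    simp only [polygonRot, Equiv.coe_addRight]
    rw [ZMod.val_add, ZMod.val_one_eq_one_mod, Nat.add_mod_mod]
  rw [hv]
  rcases (Nat.succ_le_of_lt (ZMod.val_lt z)).lt_or_eq with hlt | heq
  · rw [Nat.mod_eq_of_lt hlt]
  · rw [Nat.succ_eq_add_one] at heq
    rw [heq, Nat.mod_self, h]
    simp [hw]

/-- The darts of the `n`-gon in cyclic order. -/
def polygonDarts (n : ℕ) : List (ZMod n) := (List.range n).map (↑)

theorem nodup_polygonDarts (n : ℕ) [NeZero n] : (polygonDarts n).Nodup := by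
  refine List.Nodup.map_on ?_ List.nodup_range
  intro a ha b hb h
  have := congrArg ZMod.val h
  rwa [ZMod.val_natCast, ZMod.val_natCast, Nat.mod_eq_of_lt (List.mem_range.1 ha),
    Nat.mod_eq_of_lt (List.mem_range.1 hb)] at this

theorem mem_polygonDarts (n : ℕ) [NeZero n] (z : ZMod n) : z ∈ polygonDarts n :=
  List.mem_map.2 ⟨z.val, List.mem_range.2 z.val_lt, by simp⟩

theorem map_polygonLab (w : Word S) (n : ℕ) (h : n = w.length) [NeZero n] :
    (polygonDarts n).map (polygonLab w n h) = w := by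
  refine List.ext_getElem (by simp [polygonDarts, h]) fun k h₁ h₂ => ?_
  simp [polygonDarts, polygonLab, ZMod.val_natCast, Nat.mod_eq_of_lt (h ▸ h₂ : k < n)]

theorem stepChain_polygon {X : Type} (n : ℕ) (p : ZMod n → X) :
    StepChain p (fun z => p (polygonRot n z)) (polygonDarts n) (p 0) (p 0) := by
  have key : ∀ k : ℕ, StepChain p (fun z => p (polygonRot n z))
      ((List.range k).map ((↑) : ℕ → ZMod n)) (p 0) (p k) := by
    intro k
    induction k with
    | zero => simp [StepChain]
    | succ k ih =>
      rw [List.range_succ, List.map_append, stepChain_append]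
      exact ⟨_, ih, by simp [StepChain, polygonRot]⟩
  simpa [polygonDarts] using key n

/-- The polygon with all its darts unglued. -/
theorem exists_openDiagram_polygon (P : C6Presentation S) {W : Word S} (hne : W ≠ [])
    (hW : P.elt W = 1) : ∃ M : OpenDiagram P W, M.bdry.map M.lab = W := by
  have : NeZero W.length := ⟨by simpa using hne⟩
  have hmem := mem_polygonDarts W.length
  refine ⟨{ D := ZMod W.length, e := id, f := polygonRot _, lab := polygonLab W _ rfl
            pos := polygonPos P W _ 1, bdry := polygonDarts _, base := 0
            nodup := nodup_polygonDarts _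
            e_notMem := fun d hd => (hd (hmem d)).elim
            e_e := fun d hd => (hd (hmem d)).elim
            e_ne := fun d hd => (hd (hmem d)).elim
            lab_e := fun d hd => (hd (hmem d)).elim
            pos_f := polygonPos_rot P W _ rfl 1 hW
            pos_vertex := ⟨fun d hd => (hd (hmem d)).elim, _, stepChain_polygon _ _⟩
            base_word := faceWord_polygon W _ rfl
            face := fun d => Or.inl ⟨d.val, by rw [polygonRot_iterate]; simp⟩
            exact := fun q _ => ⟨0, fun _ => rfl, fun d hd => (hd (hmem d)).elim, _,
              stepChain_polygon _ _⟩ }, map_polygonLab W _ rfl⟩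

end GSC


namespace GSC

open Function

variable {S : Type}

/-! #### Inserting a polygon into the boundary -/

theorem isFace_map {P : C6Presentation S} {D D' : Type} {f : D → D} {f' : D' → D'}
    {lab : D → S × Bool} {lab' : D' → S × Bool} {base d : D} {φ : D → D'} (hφ : Injective φ)
    (hf : ∀ d, f' (φ d) = φ (f d)) (hlab : ∀ d, lab' (φ d) = lab d) :
    IsFace P f' lab' (φ base) (φ d) ↔ IsFace P f lab base d := by
  have hit : ∀ k d, f'^[k] (φ d) = φ (f^[k] d) := fun k d =>
    ((Semiconj.iterate_right (f := φ) (fun d => (hf d).symm) k) d).symm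
  simp only [IsFace, hit, hf, hlab, hφ.eq_iff,
    faceWord_congr hφ (fun k => hit k d) fun k => hlab _]

theorem polygon_digon (x : S × Bool) (q : Word S) (hq : q = [x, letterInv x]) (n : ℕ)
    (h : n = q.length) [NeZero n] (z : ZMod n) :
    polygonRot n (polygonRot n z) = z ∧
      polygonLab q n h (polygonRot n z) = letterInv (polygonLab q n h z) := by
  subst hq
  obtain rfl : n = 2 := h
  have h₁ : ∀ z : ZMod 2, polygonRot 2 z = z + 1 := fun _ => rfl
  have h₂ : z.val < 2 := z.val_lt
  rw [h₁, h₁]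
  refine ⟨by revert z; decide, ?_⟩
  obtain rfl | rfl : z = 0 ∨ z = 1 := by revert z; decide
  · rfl
  · exact (letterInv_letterInv x).symm

theorem OpenDiagram.insert {P : C6Presentation S} {W : Word S} (M : OpenDiagram P W)
    {u v : List M.D}
    (hM : M.bdry = u ++ v) {q : Word S} (hq : q ≠ []) (hq1 : P.elt q = 1)
    (hface : q ∈ P.rels ∨ ∃ x, q = [x, letterInv x]) :
    ∃ M' : OpenDiagram P W, M'.bdry.map M'.lab = u.map M.lab ++ q ++ v.map M.lab := by
  have : NeZero q.length := ⟨by simpa using hq⟩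
  set n := q.length with hn
  let f' : Equiv.Perm (M.D ⊕ ZMod n) := Equiv.sumCongr M.f (polygonRot n)
  let lab' : M.D ⊕ ZMod n → S × Bool := Sum.elim M.lab (polygonLab q n hn)
  let e' : M.D ⊕ ZMod n → M.D ⊕ ZMod n := Sum.elim (Sum.inl ∘ M.e) Sum.inr
  let bdry' : List (M.D ⊕ ZMod n) :=
    u.map Sum.inl ++ ((polygonDarts n).map Sum.inr ++ v.map Sum.inl)
  have hinr : ∀ z : ZMod n, Sum.inr z ∈ bdry' := fun z => by
    simp [bdry', mem_polygonDarts]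
  have hinl : ∀ d : M.D, Sum.inl d ∈ bdry' ↔ d ∈ M.bdry := fun d => by
    simp [bdry', hM]
  have hvert : ∀ {X : Type} (p : M.D → X), IsVertexFun M.e M.f M.bdry p →
      ∃ m, ∀ p' : ZMod n → X, p' 0 = m → IsVertexFun e' f' bdry' (Sum.elim p p') := by
    intro X p ⟨h₁, s, h₂⟩
    rw [hM, stepChain_append] at h₂
    obtain ⟨m, hm₁, hm₂⟩ := h₂
    refine ⟨m, fun p' hp' => ⟨?_, s, ?_⟩⟩
    · rintro (d | z) hd
      · rw [hinl] at hd
        exact h₁ d hd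
      · exact (hd (hinr z)).elim
    · rw [stepChain_append]
      refine ⟨m, (stepChain_congr (fun _ _ => rfl) (fun _ _ => rfl) _ _).2 hm₁, ?_⟩
      rw [stepChain_append]
      refine ⟨m, (stepChain_congr (φ := Sum.inr) (st := p')
        (en := fun z => p' (polygonRot n z)) (fun _ _ => rfl) (fun _ _ => rfl) _ _).2 ?_,
        (stepChain_congr (fun _ _ => rfl) (fun _ _ => rfl) _ _).2 hm₂⟩
      subst hp'
      exact stepChain_polygon n p'
  obtain ⟨m, hm⟩ := hvert M.pos M.pos_vertex
  refine ⟨{ D := M.D ⊕ ZMod n, e := e', f := f', lab := lab'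
            pos := Sum.elim M.pos (polygonPos P q n m)
            bdry := bdry', base := Sum.inl M.base
            nodup := ?_, e_notMem := ?_, e_e := ?_, e_ne := ?_, lab_e := ?_, pos_f := ?_
            pos_vertex := hm _ (by simp [polygonPos]), base_word := ?_, face := ?_
            exact := ?_ }, ?_⟩
  · have := M.nodup
    rw [hM, List.nodup_append] at this
    obtain ⟨hu, hv, huv⟩ := this
    simp only [bdry', List.nodup_append, List.mem_map, List.mem_append]
    refine ⟨hu.map Sum.inl_injective, ⟨(nodup_polygonDarts n).map Sum.inr_injective,
      hv.map Sum.inl_injective, ?_⟩, ?_⟩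
    · rintro _ ⟨z, -, rfl⟩ _ ⟨d, -, rfl⟩
      simp
    · rintro _ ⟨d, hd, rfl⟩ _ (⟨z, -, rfl⟩ | ⟨d', hd', rfl⟩)
      · simp
      · simpa using huv d hd d' hd'
  · rintro (d | z) hd
    · rw [hinl] at hd
      exact (hinl _).not.2 (M.e_notMem d hd)
    · exact (hd (hinr z)).elim
  · rintro (d | z) hd
    · rw [hinl] at hd
      exact congrArg Sum.inl (M.e_e d hd)
    · exact (hd (hinr z)).elim
  · rintro (d | z) hd
    · rw [hinl] at hd
      exact fun h => M.e_ne d hd (Sum.inl_injective h)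
    · exact (hd (hinr z)).elim
  · rintro (d | z) hd
    · rw [hinl] at hd
      exact M.lab_e d hd
    · exact (hd (hinr z)).elim
  · rintro (d | z)
    · exact M.pos_f d
    · exact polygonPos_rot P q n hn m hq1 z
  · refine Eq.trans ?_ M.base_word
    exact faceWord_congr Sum.inl_injective
      (fun k => (Semiconj.iterate_right (f := Sum.inl) (ga := M.f) (gb := f')
        (fun d => rfl) k M.base).symm) fun k => rfl
  · rintro (d | z)
    · exact (isFace_map Sum.inl_injective (fun _ => rfl) fun _ => rfl).2 (M.face d)
    · have hit : ∀ (k : ℕ) z, f'^[k] (Sum.inr z) = Sum.inr ((polygonRot n)^[k] z) := fun k z =>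
        (Semiconj.iterate_right (f := Sum.inr) (ga := polygonRot n) (gb := f')
          (fun d => rfl) k z).symm
      right
      rcases hface with hr | ⟨x, hx⟩
      · left
        have hz : z = (polygonRot n)^[z.val] 0 := by rw [polygonRot_iterate]; simp
        rw [hz, faceWord_congr (f := polygonRot n) (lab := polygonLab q n hn)
          Sum.inr_injective (fun k => hit k _) fun k => rfl,
          faceWord_iterate (polygonRot n).injective, faceWord_polygon]
        exact P.rotate_mem q hr _
      · right
        obtain ⟨h₁, h₂⟩ := polygon_digon x q hx n hn z
        exact ⟨congrArg Sum.inr h₁, h₂⟩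
  · intro p hp
    obtain ⟨c, h₁, h₂⟩ := M.exact (fun d => p (Sum.inl d)) fun d hd =>
      hp (Sum.inl d) ((hinl d).not.2 hd)
    obtain ⟨m, hm⟩ := hvert _ h₂
    refine ⟨Sum.elim c fun _ => m - p (Sum.inr 0), ?_, ?_⟩
    · rintro (d | z)
      · exact h₁ d
      · rfl
    · convert hm (fun z => p (Sum.inr z) + (m - p (Sum.inr 0))) (by ring) using 1
      ext (d | z) <;> rfl
  · simp only [bdry', List.map_append, List.map_map, List.append_assoc]
    congr 2
    exact map_polygonLab q n hn

end GSC


namespace GSC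

open Function

variable {S : Type}

/-! #### Gluing two consecutive boundary darts -/

open Classical in
theorem OpenDiagram.glue {P : C6Presentation S} {W : Word S} (M : OpenDiagram P W)
    {u v : List M.D} {a b : M.D} (hM : M.bdry = u ++ a :: b :: v)
    (hlab : M.lab b = letterInv (M.lab a)) :
    ∃ M' : OpenDiagram P W, M'.bdry.map M'.lab = u.map M.lab ++ v.map M.lab := by
  have hnd := M.nodup
  rw [hM, List.nodup_append] at hnd
  obtain ⟨hu, hv, huv⟩ := hnd
  rw [List.nodup_cons, List.nodup_cons] at hv
  obtain ⟨hav, hbv, hv⟩ := hv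
  have hab : a ≠ b := fun h => hav (by simp [h])
  have hau : a ∉ u := fun h => huv a h a (by simp) rfl
  have hbu : b ∉ u := fun h => huv b h b (by simp) rfl
  have hav' : a ∉ v := fun h => hav (by simp [h])
  have hmem : ∀ d, d ∈ M.bdry ↔ d = a ∨ d = b ∨ d ∈ u ++ v := fun d => by
    simp only [hM, List.mem_append, List.mem_cons]; tauto
  have ha : a ∉ u ++ v := by simp [hau, hav']
  have hb : b ∉ u ++ v := by simp [hbu, hbv]
  let e' : M.D → M.D := fun d => if d = a then b else if d = b then a else M.e d
  have e'a : e' a = b := by simp [e']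
  have e'b : e' b = a := by simp [e', hab.symm]
  have e'd : ∀ d, d ∉ M.bdry → e' d = M.e d := fun d hd => by
    rw [hmem] at hd
    push Not at hd
    simp [e', hd.1, hd.2.1]
  have cases : ∀ d, d ∉ u ++ v → d = a ∨ d = b ∨ d ∉ M.bdry := fun d hd => by
    rw [hmem]; tauto
  have hvert : ∀ {X : Type} (p : M.D → X), IsVertexFun M.e M.f M.bdry p →
      (p b = p (M.f a) → p (M.f b) = p a) → IsVertexFun e' M.f (u ++ v) p := by
    intro X p ⟨h₁, s, h₂⟩ h
    rw [hM, stepChain_append] at h₂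
    obtain ⟨m, hm, h₃, h₄, h₅⟩ := h₂
    have h₆ := h h₄
    refine ⟨fun d hd => ?_, s, (stepChain_append _ _ _ _ _ _).2 ⟨m, hm, ?_⟩⟩
    · rcases cases d hd with rfl | rfl | hd
      · rw [e'a, h₄]
      · rw [e'b, h₆]
      · rw [e'd d hd, h₁ d hd]
    · simpa only [h₆, h₃] using h₅
  refine ⟨{ D := M.D, e := e', f := M.f, lab := M.lab, pos := M.pos, bdry := u ++ v
            base := M.base, nodup := ?_, e_notMem := ?_, e_e := ?_, e_ne := ?_, lab_e := ?_
            pos_f := M.pos_f, pos_vertex := ?_, base_word := M.base_word, face := M.face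
            exact := ?_ }, by simp⟩
  · exact List.nodup_append.2 ⟨hu, hv, fun x hx y hy => huv x hx y (by simp [hy])⟩
  · intro d hd
    rcases cases d hd with rfl | rfl | hd
    · rwa [e'a]
    · rwa [e'b]
    · have := M.e_notMem d hd
      rw [hmem] at this
      rw [e'd d hd]
      tauto
  · intro d hd
    rcases cases d hd with rfl | rfl | hd
    · rw [e'a, e'b]
    · rw [e'b, e'a]
    · rw [e'd d hd, e'd _ (M.e_notMem d hd), M.e_e d hd]
  · intro d hd
    rcases cases d hd with rfl | rfl | hd
    · rw [e'a]; exact hab.symm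
    · rw [e'b]; exact hab
    · rw [e'd d hd]; exact M.e_ne d hd
  · intro d hd
    rcases cases d hd with rfl | rfl | hd
    · rw [e'a, hlab]
    · rw [e'b, hlab, letterInv_letterInv]
    · rw [e'd d hd, M.lab_e d hd]
  · exact hvert M.pos M.pos_vertex fun h => by
      rw [M.pos_f, h, M.pos_f, hlab, letter_letterInv, mul_inv_cancel_right]
  · intro q hq
    obtain ⟨c, h₁, h₂⟩ := M.exact q fun d hd => by
      have := hq d fun h => hd ((hmem d).2 (by tauto))
      rwa [e'd d hd] at this
    refine ⟨c, h₁, hvert _ h₂ fun h => ?_⟩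
    have := hq a ha
    rw [e'a] at this
    have h3 := h₁ a
    have h4 := h₁ b
    linarith

/-! #### Existence of diagrams -/

/-- The words occurring as boundary words of partially glued diagrams with base face `W`. -/
def Reachable (P : C6Presentation S) (W V : Word S) : Prop :=
  ∃ M : OpenDiagram P W, M.bdry.map M.lab = V

theorem Reachable.insert {P : C6Presentation S} {W u v q : Word S} (h : Reachable P W (u ++ v))
    (hq1 : P.elt q = 1) (hface : q ∈ P.rels ∨ ∃ x, q = [x, letterInv x]) :
    Reachable P W (u ++ q ++ v) := by
  rcases eq_or_ne q [] with rfl | hq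
  · simpa using h
  obtain ⟨M, hM⟩ := h
  obtain ⟨u', v', h₁, h₂, h₃⟩ := List.map_eq_append_iff.1 hM
  obtain ⟨M', hM'⟩ := M.insert h₁ hq hq1 hface
  exact ⟨M', by rw [hM', h₂, h₃]⟩

theorem Reachable.red {P : C6Presentation S} {W V V' : Word S} (h : Reachable P W V)
    (hred : FreeGroup.Red V V') : Reachable P W V' := by
  induction hred with
  | refl => exact h
  | tail _ hstep ih =>
    cases hstep with
    | @not L₁ L₂ x b =>
      obtain ⟨M, hM⟩ := ih
      obtain ⟨u, w, h₁, h₂, h₃⟩ := List.map_eq_append_iff.1 hM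
      obtain ⟨a, w, rfl, h₄, h₅⟩ := List.map_eq_cons_iff.1 h₃
      obtain ⟨a', w, rfl, h₆, h₇⟩ := List.map_eq_cons_iff.1 h₅
      obtain ⟨M', hM'⟩ := M.glue h₁ (by rw [h₄, h₆]; rfl)
      exact ⟨M', by rw [hM', h₂, h₇]⟩

theorem Reachable.insert_conj {P : C6Presentation S} {W u v g r : Word S}
    (h : Reachable P W (u ++ v)) (hr : r ∈ P.rels) :
    Reachable P W (u ++ (g ++ r ++ wordInv g) ++ v) := by
  have h' : Reachable P W (u ++ (g ++ wordInv g) ++ v) := by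
    induction g generalizing u v with
    | nil => simpa [wordInv] using h
    | cons x g ih =>
      have h₁ := h.insert (q := [x, letterInv x]) (by simp) (Or.inr ⟨x, rfl⟩)
      have h₂ := ih (u := u ++ [x]) (v := letterInv x :: v) (by simpa using h₁)
      rw [show x :: g = [x] ++ g from rfl, wordInv_append, wordInv_singleton]
      simpa using h₂
  have := Reachable.insert (u := u ++ g) (v := wordInv g ++ v) (by simpa using h')
    (elt_of_mem_rels P hr) (Or.inl hr)
  simpa using this

theorem exists_diagram (P : C6Presentation S) {W : Word S} (hne : W ≠ []) (hW : P.elt W = 1) :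
    Nonempty (Diagram P W) := by
  have hN : (wordVal W)⁻¹ ∈ Subgroup.normalClosure (wordVal '' P.rels) :=
    inv_mem ((elt_eq_one_iff P W).1 hW)
  obtain ⟨l, hl, hx⟩ := exists_conjugates P hN
  have hreach : ∀ l : List (Word S × Word S), (∀ c ∈ l, c.2 ∈ P.rels) →
      Reachable P W (W ++ l.flatMap fun c => c.1 ++ c.2 ++ wordInv c.1) := by
    intro l
    induction l with
    | nil =>
      intro _
      rw [List.flatMap_nil, List.append_nil]
      exact exists_openDiagram_polygon P hne hW
    | cons c l ih =>
      intro hl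
      have h₁ := ih fun c hc => hl c (by simp [hc])
      simpa using h₁.insert_conj (g := c.1) (hl c (by simp))
  have hred : FreeGroup.Red (W ++ l.flatMap fun c => c.1 ++ c.2 ++ wordInv c.1) [] := by
    refine red_nil_of_wordVal_eq_one ?_
    rw [wordVal_eq_mk, ← FreeGroup.mul_mk, ← wordVal_eq_mk, ← wordVal_eq_mk, ← hx, mul_inv_cancel]
  obtain ⟨M, hM⟩ := (hreach l hl).red hred
  exact ⟨M.toDiagram (by simpa using hM)⟩

end GSC


namespace GSC

open Function

variable {S : Type}

/-! ### Reduction of diagrams -/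

/-- The dart `d` lies on the base face. -/
def Diagram.InBase {P : C6Presentation S} {W : Word S} (M : Diagram P W) (d : M.D) : Prop :=
  ∃ k, M.f^[k] M.base = d

theorem Diagram.inBase_f {P : C6Presentation S} {W : Word S} (M : Diagram P W) (d : M.D) :
    M.InBase (M.f d) ↔ M.InBase d := by
  constructor
  · rintro ⟨k, hk⟩
    have hp := minimalPeriod_pos M.f.injective M.base
    refine ⟨k + (minimalPeriod M.f M.base - 1), M.f.injective ?_⟩
    refine (iterate_succ_apply' M.f _ _).symm.trans ?_
    rw [show (k + (minimalPeriod M.f M.base - 1)).succ =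
      k + minimalPeriod M.f M.base by omega, iterate_add_apply, iterate_minimalPeriod, hk]
  · rintro ⟨k, rfl⟩
    exact ⟨k + 1, iterate_succ_apply' _ _ _⟩

theorem Diagram.inBase_iterate {P : C6Presentation S} {W : Word S} (M : Diagram P W) (d : M.D)
    (k : ℕ) : M.InBase (M.f^[k] d) ↔ M.InBase d := by
  induction k with
  | zero => rfl
  | succ k ih => rw [iterate_succ_apply', M.inBase_f, ih]

theorem Diagram.inBase_base {P : C6Presentation S} {W : Word S} (M : Diagram P W) :
    M.InBase M.base := ⟨0, rfl⟩

theorem Diagram.pos_e_eq {P : C6Presentation S} {W : Word S} (M : Diagram P W) (d : M.D) :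
    M.pos (M.e d) = M.pos (M.f d) := by
  rw [M.pos_e, M.pos_f]

open Classical in
/-- A digon can be removed by gluing its two neighbours to each other. -/
theorem Diagram.exists_card_lt_of_digon {P : C6Presentation S} {W : Word S} (M : Diagram P W)
    {a b : M.D} (hab : M.f a = b) (hba : M.f b = a) (hl : M.lab b = letterInv (M.lab a))
    (ha : ¬ M.InBase a) : ∃ M' : Diagram P W, Fintype.card M'.D < Fintype.card M.D := by
  have hne : a ≠ b := by
    rintro rfl
    exact letterInv_ne _ hl.symm
  have hb : ¬ M.InBase b := by rwa [← hab, M.inBase_f]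
  have hf : ∀ x, (M.f x ≠ a ∧ M.f x ≠ b) ↔ (x ≠ a ∧ x ≠ b) := fun x => by
    have h₁ : M.f x = a ↔ x = b := by rw [← hba, M.f.injective.eq_iff]
    have h₂ : M.f x = b ↔ x = a := by rw [← hab, M.f.injective.eq_iff]
    rw [Ne, Ne, h₁, h₂, and_comm]
  have hinj : ∀ x y, M.e x = y ↔ x = M.e y := fun x y =>
    ⟨fun h => by rw [← h, M.e_e], fun h => by rw [h, M.e_e]⟩
  let e' : M.D → M.D := fun x =>
    if M.e x = a then M.e b else if M.e x = b then M.e a else M.e x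
  have he' : ∀ x, x ≠ a ∧ x ≠ b → e' x ≠ a ∧ e' x ≠ b := by
    rintro x ⟨hxa, hxb⟩
    simp only [e']
    split_ifs with h₁ h₂
    · rw [hinj] at h₁
      subst h₁
      refine ⟨fun h => hxb ?_, M.e_ne b⟩
      rw [hinj] at h
      exact h.symm
    · rw [hinj] at h₂
      subst h₂
      refine ⟨M.e_ne a, fun h => hxa ?_⟩
      rw [hinj] at h
      exact h.symm
    · exact ⟨h₁, h₂⟩
  have hsplit : ∀ x, x ≠ a ∧ x ≠ b →
      (x = M.e a ∧ e' x = M.e b) ∨ (x = M.e b ∧ e' x = M.e a) ∨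
      (M.e x ≠ a ∧ M.e x ≠ b ∧ e' x = M.e x) := by
    rintro x -
    simp only [e']
    split_ifs with h₁ h₂
    · rw [hinj] at h₁
      simp [h₁]
    · rw [hinj] at h₂
      simp [h₂]
    · simp [h₁, h₂]
  refine ⟨{ D := {x // x ≠ a ∧ x ≠ b}, e := fun x => ⟨e' x, he' x x.2⟩
            f := M.f.subtypePerm hf, lab := fun x => M.lab x, pos := fun x => M.pos x
            base := ⟨M.base, fun h => ha (h ▸ M.inBase_base), fun h => hb (h ▸ M.inBase_base)⟩
            e_e := ?_, e_ne := ?_, lab_e := ?_, pos_f := fun d => M.pos_f d, pos_e := ?_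
            base_word := ?_, face := ?_, exact := ?_ }, ?_⟩
  · rintro ⟨x, hx⟩
    refine Subtype.ext ?_
    change e' (e' x) = x
    rcases hsplit x hx with ⟨h, h'⟩ | ⟨h, h'⟩ | ⟨h, h', h''⟩
    · rw [h', h]; simp [e', M.e_e, hne.symm]
    · rw [h', h]; simp [e', M.e_e]
    · rw [h'']; simp [e', M.e_e, hx]
  · rintro ⟨x, hx⟩ h
    have h : e' x = x := congrArg Subtype.val h
    rcases hsplit x hx with ⟨h₁, h'⟩ | ⟨h₁, h'⟩ | ⟨-, -, h''⟩
    · rw [h', h₁] at h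
      exact hne (by rw [← M.e_e a, ← h, M.e_e])
    · rw [h', h₁] at h
      exact hne (by rw [← M.e_e a, h, M.e_e])
    · exact M.e_ne x (h'' ▸ h)
  · rintro ⟨x, hx⟩
    change M.lab (e' x) = letterInv (M.lab x)
    rcases hsplit x hx with ⟨h, h'⟩ | ⟨h, h'⟩ | ⟨-, -, h''⟩
    · rw [h', h, M.lab_e, M.lab_e, hl]
    · rw [h', h, M.lab_e, M.lab_e, hl, letterInv_letterInv]
    · rw [h'', M.lab_e]
  · rintro ⟨x, hx⟩
    change M.pos (e' x) = M.pos x * P.letter (M.lab x)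
    rw [← M.pos_e]
    rcases hsplit x hx with ⟨h, h'⟩ | ⟨h, h'⟩ | ⟨-, -, h''⟩
    · rw [h', h, M.e_e, M.pos_e_eq, hba]
    · rw [h', h, M.e_e, M.pos_e_eq, hab]
    · rw [h'']
  · refine Eq.trans ?_ M.base_word
    refine (faceWord_congr Subtype.val_injective (fun k => ?_) fun k => rfl).symm
    exact (Semiconj.iterate_right (f := Subtype.val) (ga := M.f.subtypePerm hf) (gb := M.f)
      (fun d => rfl) k _).symm
  · intro d
    exact (isFace_map Subtype.val_injective (fun _ => rfl) fun _ => rfl).1 (M.face d)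
  · intro q hq
    let δ : ℚ := if h : M.e a ≠ a ∧ M.e a ≠ b then
      q ⟨M.f (M.e a), (hf _).2 h⟩ - q ⟨M.e a, h⟩ else 0
    let q' : M.D → ℚ := fun x =>
      if h : x ≠ a ∧ x ≠ b then q ⟨x, h⟩ else if x = a then 0 else - δ
    have q'a : q' a = 0 := by simp [q']
    have q'b : q' b = - δ := by simp [q', hne.symm]
    have q'x : ∀ x (h : x ≠ a ∧ x ≠ b), q' x = q ⟨x, h⟩ := fun x h => by simp only [q', dif_pos h]
    have hδ : M.e a ≠ b → q' (M.f (M.e a)) - q' (M.e a) = δ := fun h => by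
      have h' : M.e a ≠ a ∧ M.e a ≠ b := ⟨M.e_ne a, h⟩
      rw [q'x _ h', q'x _ ((hf _).2 h')]
      simp only [δ, dif_pos h']
    have hδ' : M.e a ≠ b → q' (M.f (M.e b)) - q' (M.e b) = - δ := fun h => by
      have h' : M.e a ≠ a ∧ M.e a ≠ b := ⟨M.e_ne a, h⟩
      have h'' : M.e b ≠ a ∧ M.e b ≠ b :=
        ⟨fun h => h'.2 (by rw [← h, M.e_e]), M.e_ne b⟩
      have key := hq ⟨M.e a, h'⟩
      have h3 : (⟨e' (M.e a), he' _ h'⟩ : {x // x ≠ a ∧ x ≠ b}) = ⟨M.e b, h''⟩ :=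
        Subtype.ext (by simp [e', M.e_e])
      simp only [h3] at key
      rw [q'x _ h'', q'x _ ((hf _).2 h''), ← hδ h, q'x _ h', q'x _ ((hf _).2 h')]
      exact key
    obtain ⟨c, h₁, h₂⟩ := M.exact q' fun x => by
      by_cases heab : M.e a = b
      · have heba : M.e b = a := by rw [← heab, M.e_e]
        by_cases hxa : x = a
        · subst hxa
          rw [heab, hab, hba]; ring
        by_cases hxb : x = b
        · subst hxb
          rw [heba, hab, hba]; ring
        have hx : x ≠ a ∧ x ≠ b := ⟨hxa, hxb⟩
        have h1 : M.e x ≠ a := fun h => hxb (by rw [← M.e_e x, h, heab])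
        have h2 : M.e x ≠ b := fun h => hxa (by rw [← M.e_e x, h, heba])
        have key := hq ⟨x, hx⟩
        have h3 : (⟨e' x, he' _ hx⟩ : {x // x ≠ a ∧ x ≠ b}) = ⟨M.e x, h1, h2⟩ :=
          Subtype.ext (by simp [e', h1, h2])
        simp only [h3] at key
        rw [q'x _ hx, q'x _ ((hf _).2 hx), q'x _ ⟨h1, h2⟩, q'x _ ((hf _).2 ⟨h1, h2⟩)]
        exact key
      · have hδ := hδ heab
        have hδ' := hδ' heab
        by_cases hxa : x = a
        · subst hxa
          rw [hδ, hab, q'a, q'b]; ring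
        by_cases hxb : x = b
        · subst hxb
          rw [hδ', hba, q'a, q'b]; ring
        have hx : x ≠ a ∧ x ≠ b := ⟨hxa, hxb⟩
        rcases hsplit x hx with ⟨h, -⟩ | ⟨h, -⟩ | ⟨h1, h2, h3⟩
        · subst h
          rw [hδ, M.e_e, hab, q'a, q'b]; ring
        · subst h
          rw [hδ', M.e_e, hba, q'a, q'b]; ring
        · have key := hq ⟨x, hx⟩
          simp only [h3] at key
          rw [q'x _ hx, q'x _ ((hf _).2 hx), q'x _ ⟨h1, h2⟩, q'x _ ((hf _).2 ⟨h1, h2⟩)]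
          exact key
    refine ⟨fun x => c x, fun x => h₁ x, ?_⟩
    rintro ⟨x, hx⟩
    have key : q' (e' x) + c (e' x) = q' (M.f x) + c (M.f x) := by
      rw [← h₂]
      rcases hsplit x hx with ⟨h, h'⟩ | ⟨h, h'⟩ | ⟨-, -, h''⟩
      · rw [h', h, M.e_e, h₂, hba]
      · rw [h', h, M.e_e, h₂, hab]
      · rw [h'']
    rw [q'x _ (he' x hx), q'x _ ((hf x).2 hx)] at key
    exact key
  · exact Fintype.card_subtype_lt (x := a) (by simp)

end GSC


namespace GSC

open Function

variable {S : Type}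

theorem zpow_apply_eq_iff {D : Type} (f : Equiv.Perm D) (d : D) (k l : ℤ) :
    (f ^ k) d = (f ^ l) d ↔ (minimalPeriod f d : ℤ) ∣ k - l := by
  have := MulAction.zpow_smul_eq_iff_minimalPeriod_dvd (a := f) (b := d) (n := k - l)
  simp only [Equiv.Perm.smul_def] at this
  rw [← this, sub_eq_neg_add, zpow_add, Equiv.Perm.mul_apply, zpow_neg, Equiv.Perm.inv_eq_iff_eq]

theorem zpow_eq_iterate {D : Type} (f : Equiv.Perm D) (d : D) (k : ℕ) :
    (f ^ (k : ℤ)) d = f^[k] d := by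
  rw [zpow_natCast, Equiv.Perm.iterate_eq_pow]

open Equiv.Perm in
/-- A function on darts with prescribed differential along an orbit away from a given dart. -/
theorem exists_integral_off_point {D : Type} [Finite D] (f : Equiv.Perm D) (d : D) (h : D → ℚ) :
    ∃ K : D → ℚ, ∀ x, SameCycle f d x → x ≠ d → K (f x) - K x = h x := by
  classical
  set n := minimalPeriod f d with hn
  have hpos : 0 < n := minimalPeriod_pos f.injective d
  let H : ℕ → ℚ := fun k => ∑ j ∈ Finset.range k, h (f^[j] d)
  have hex : ∀ x, SameCycle f d x → ∃ k : ℕ, k < n ∧ f^[k] d = x := by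
    rintro _ ⟨k, rfl⟩
    have h0 := Int.emod_nonneg k (b := n) (by omega)
    refine ⟨(k % n).toNat, by have := Int.emod_lt_of_pos k (b := n) (by omega); omega, ?_⟩
    rw [← zpow_eq_iterate, zpow_apply_eq_iff, Int.toNat_of_nonneg h0]
    exact ⟨-(k / n), by have := Int.emod_add_mul_ediv k n; linarith⟩
  choose! κ hκ using hex
  have hκ' : ∀ k : ℕ, k < n → κ (f^[k] d) = k := fun k hk => by
    obtain ⟨h₁, h₂⟩ := hκ (f^[k] d) ⟨k, zpow_eq_iterate f d k⟩
    exact (iterate_eq_iterate_iff_of_lt_minimalPeriod h₁ hk).1 h₂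
  refine ⟨fun x => if x = d then H n else H (κ x), fun x hx hxd => ?_⟩
  obtain ⟨h₁, h₂⟩ := hκ x hx
  have h₃ : f x = f^[κ x + 1] d := by rw [iterate_succ_apply', h₂]
  have h₄ : H (κ x + 1) - H (κ x) = h x := by
    simp only [H, Finset.sum_range_succ, h₂]; ring
  simp only [if_neg hxd]
  rw [← h₄]
  rcases (Nat.succ_le_of_lt h₁).lt_or_eq with hlt | heq
  · have h₅ : f x ≠ d := fun h => by
      have := hκ' _ hlt
      rw [Nat.succ_eq_add_one, ← h₃, h] at this
      have h0 := hκ' 0 hpos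
      simp only [iterate_zero, id] at h0
      omega
    rw [if_neg h₅, h₃, hκ' _ hlt]
  · have h₅ : f x = d := by
      rw [h₃, ← Nat.succ_eq_add_one, heq, iterate_minimalPeriod]
    rw [if_pos h₅, ← heq]

open Equiv.Perm in
/-- A diagram in which the faces on the two sides of an edge carry mutually inverse labels can be
changed so that a digon appears at this edge. -/
theorem Diagram.exists_digon_of_mirror {P : C6Presentation S} {W : Word S} (M : Diagram P W)
    {d₀ : M.D} (hper : minimalPeriod M.f d₀ = minimalPeriod M.f (M.e d₀))
    (hlab : ∀ k : ℤ, M.lab ((M.f ^ k) d₀) = letterInv (M.lab ((M.f ^ (-k)) (M.e d₀))))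
    (hdis : ¬ SameCycle M.f d₀ (M.e d₀)) (hd : ¬ M.InBase d₀) (hc : ¬ M.InBase (M.e d₀)) :
    ∃ M' : Diagram P W, Fintype.card M'.D < Fintype.card M.D := by
  classical
  set c₀ := M.e d₀ with hc₀
  have hec : M.e c₀ = d₀ := M.e_e d₀
  have hdc : d₀ ≠ c₀ := fun h => hdis (h ▸ SameCycle.refl _ _)
  have hμ : ∃ μ : M.D → M.D, (∀ k : ℤ, μ ((M.f ^ k) d₀) = (M.f ^ (-k)) c₀) ∧
      (∀ k : ℤ, μ ((M.f ^ k) c₀) = (M.f ^ (-k)) d₀) := by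
    refine ⟨fun x => if h : SameCycle M.f d₀ x then (M.f ^ (-h.choose)) c₀ else
      if h : SameCycle M.f c₀ x then (M.f ^ (-h.choose)) d₀ else x, fun k => ?_, fun k => ?_⟩
    · have h : SameCycle M.f d₀ ((M.f ^ k) d₀) := ⟨k, rfl⟩
      simp only [dif_pos h]
      have := h.choose_spec
      rw [zpow_apply_eq_iff, hper] at this
      rwa [zpow_apply_eq_iff, neg_sub_neg, dvd_sub_comm]
    · have h' : SameCycle M.f c₀ ((M.f ^ k) c₀) := ⟨k, rfl⟩
      have h : ¬ SameCycle M.f d₀ ((M.f ^ k) c₀) := fun h => hdis (h.trans h'.symm)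
      simp only [dif_neg h, dif_pos h']
      have := h'.choose_spec
      rw [zpow_apply_eq_iff, ← hper] at this
      rwa [zpow_apply_eq_iff, neg_sub_neg, dvd_sub_comm]
  obtain ⟨μ, μD, μC⟩ := hμ
  let O : M.D → Prop := fun x => SameCycle M.f d₀ x ∨ SameCycle M.f c₀ x
  have μd : μ d₀ = c₀ := by simpa using μD 0
  have μc : μ c₀ = d₀ := by simpa using μC 0
  have μμ : ∀ x, O x → μ (μ x) = x := by
    rintro x (⟨k, rfl⟩ | ⟨k, rfl⟩)
    · rw [μD, μC, neg_neg]
    · rw [μC, μD, neg_neg]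
  have μ₁ : ∀ x, SameCycle M.f d₀ x → SameCycle M.f c₀ (μ x) := by
    rintro x ⟨k, rfl⟩
    exact ⟨-k, (μD k).symm⟩
  have μ₂ : ∀ x, SameCycle M.f c₀ x → SameCycle M.f d₀ (μ x) := by
    rintro x ⟨k, rfl⟩
    exact ⟨-k, (μC k).symm⟩
  have μO : ∀ x, O x → O (μ x) := fun x hx => hx.symm.imp (μ₂ x) (μ₁ x)
  have fO : ∀ x, O (M.f x) ↔ O x := fun x => by simp only [O, sameCycle_apply_right]
  have μf : ∀ x, O x → M.f (μ (M.f x)) = μ x := by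
    rintro x (⟨k, rfl⟩ | ⟨k, rfl⟩)
    · have h : M.f ((M.f ^ k) d₀) = (M.f ^ (1 + k)) d₀ := by rw [zpow_add]; rfl
      rw [h, μD, μD, ← Equiv.Perm.mul_apply, ← zpow_one_add]
      congr 2; ring
    · have h : M.f ((M.f ^ k) c₀) = (M.f ^ (1 + k)) c₀ := by rw [zpow_add]; rfl
      rw [h, μC, μC, ← Equiv.Perm.mul_apply, ← zpow_one_add]
      congr 2; ring
  have μlab : ∀ x, O x → M.lab (μ x) = letterInv (M.lab x) := by
    rintro x (⟨k, rfl⟩ | ⟨k, rfl⟩)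
    · rw [μD, hlab, letterInv_letterInv]
    · rw [μC, hlab, neg_neg]
  have baseO : ∀ x, O x → ¬ M.InBase x := by
    have key : ∀ d, ¬ M.InBase d → ∀ x, SameCycle M.f d x → ¬ M.InBase x := by
      intro d hd x hx
      obtain ⟨k, rfl⟩ := hx.exists_nat_pow_eq
      rwa [← Equiv.Perm.iterate_eq_pow, M.inBase_iterate]
    rintro x (h | h)
    exacts [key _ hd x h, key _ hc x h]
  have μpos : ∀ x, O x → M.pos (M.f (μ x)) = M.pos x := by
    have h₁ : ∀ k : ℕ, M.pos (M.f (μ ((M.f ^ (k : ℤ)) d₀))) = M.pos ((M.f ^ (k : ℤ)) d₀) := by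
      intro k
      induction k with
      | zero => simp [μd, ← M.pos_e_eq, hec]
      | succ k ih =>
        have hO : O ((M.f ^ (k : ℤ)) d₀) := Or.inl ⟨k, rfl⟩
        have h : (M.f ^ ((k + 1 : ℕ) : ℤ)) d₀ = M.f ((M.f ^ (k : ℤ)) d₀) := by
          rw [Nat.cast_add, add_comm, zpow_add]; rfl
        rw [h, μf _ hO, M.pos_f, ← ih, M.pos_f, μlab _ hO, letter_letterInv, inv_mul_cancel_right]
    have h₂ : ∀ x, SameCycle M.f d₀ x → M.pos (M.f (μ x)) = M.pos x := fun x hx => by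
      obtain ⟨k, rfl⟩ := hx.exists_nat_pow_eq
      simpa using h₁ k
    rintro x (h | h)
    · exact h₂ x h
    · have := h₂ _ (μ₂ x h)
      rw [μμ x (Or.inr h), M.pos_f] at this
      rw [M.pos_f, μlab _ (Or.inr h), ← this, letter_letterInv, mul_inv_cancel_right]
  let f' : Equiv.Perm M.D :=
    { toFun := fun x => if O x then μ x else M.f x
      invFun := fun x => if O x then μ x else M.f.symm x
      left_inv := fun x => by
        by_cases h : O x
        · simp [h, μO, μμ]
        · simp [h, fO]
      right_inv := fun x => by
        by_cases h : O x
        · simp [h, μO, μμ]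
        · have : ¬ O (M.f.symm x) := fun h' => h (by simpa using (fO _).2 h')
          simp [h, this] }
  have f'O : ∀ x, O x → f' x = μ x := fun x h => if_pos h
  have f'N : ∀ x, ¬ O x → f' x = M.f x := fun x h => if_neg h
  have f'it : ∀ x, ¬ O x → ∀ k, f'^[k] x = M.f^[k] x ∧ ¬ O (f'^[k] x) := by
    intro x hx k
    induction k with
    | zero => exact ⟨rfl, hx⟩
    | succ k ih =>
      rw [iterate_succ_apply', iterate_succ_apply', f'N _ ih.2, fO, ih.1]
      exact ⟨rfl, ih.1 ▸ ih.2⟩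
  have hbase : ¬ O M.base := fun h => baseO _ h M.inBase_base
  have hfw : ∀ x, ¬ O x → faceWord f' M.lab x = faceWord M.f M.lab x := fun x hx =>
    faceWord_congr (φ := id) injective_id (fun k => (f'it x hx k).1) fun k => rfl
  have Od : O d₀ := Or.inl (SameCycle.refl _ _)
  have Oc : O c₀ := Or.inr (SameCycle.refl _ _)
  let M₁ : Diagram P W :=
    { D := M.D, e := M.e, f := f', lab := M.lab, pos := M.pos, base := M.base
      e_e := M.e_e, e_ne := M.e_ne, lab_e := M.lab_e, pos_e := M.pos_e
      base_word := (hfw _ hbase).trans M.base_word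
      pos_f := fun x => by
        by_cases h : O x
        · have := μpos _ (μO x h)
          rw [μμ x h] at this
          rw [f'O x h, ← this, M.pos_f]
        · rw [f'N x h, M.pos_f]
      face := fun x => by
        by_cases h : O x
        · right; right
          rw [f'O x h, f'O _ (μO x h), μμ x h, μlab x h]
          exact ⟨rfl, rfl⟩
        · rcases M.face x with ⟨k, hk⟩ | h' | ⟨h₁, h₂⟩
          · exact Or.inl ⟨k, ((f'it _ hbase k).1).trans hk⟩
          · exact Or.inr (Or.inl (by rwa [hfw x h]))
          · right; right
            rw [f'N x h, f'N _ ((fO x).not.2 h)]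
            exact ⟨h₁, h₂⟩
      exact := ?_ }
  · refine M₁.exists_card_lt_of_digon (a := d₀) (b := c₀) ((f'O _ Od).trans μd)
      ((f'O _ Oc).trans μc) (μd ▸ μlab d₀ Od) ?_
    rintro ⟨k, hk⟩
    exact (f'it _ hbase k).2 (by rw [hk]; exact Od)
  · intro q hq
    have hq : ∀ x, q (f' (M.e x)) - q (M.e x) = -(q (f' x) - q x) := hq
    obtain ⟨K, hK⟩ := exists_integral_off_point M.f d₀ fun x => q (f' x) - q x
    have hanti : ∀ x, O x → q (f' (μ x)) - q (μ x) = -(q (f' x) - q x) := fun x hx => by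
      rw [f'O _ (μO x hx), μμ x hx, f'O x hx]; ring
    let q₂ : M.D → ℚ := fun x => if SameCycle M.f d₀ x then K x else
      if SameCycle M.f c₀ x then K (M.f (μ x)) else q x
    have q₂D : ∀ x, SameCycle M.f d₀ x → q₂ x = K x := fun x hx => if_pos hx
    have q₂C : ∀ x, SameCycle M.f c₀ x → q₂ x = K (M.f (μ x)) := fun x hx => by
      have : ¬ SameCycle M.f d₀ x := fun h => hdis (h.trans hx.symm)
      simp only [q₂, if_neg this, if_pos hx]
    have q₂N : ∀ x, ¬ O x → q₂ x = q x := fun x hx => by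
      simp only [O, not_or] at hx
      simp only [q₂, if_neg hx.1, if_neg hx.2]
    have dq₂ : ∀ x, x ≠ d₀ → x ≠ c₀ → q₂ (M.f x) - q₂ x = q (f' x) - q x := by
      intro x hxd hxc
      by_cases hx : O x
      · rcases hx with hx | hx
        · rw [q₂D _ hx, q₂D _ (sameCycle_apply_right.2 hx), hK x hx hxd]
        · have h := hK (μ x) (μ₂ x hx) fun h => hxc (by rw [← μμ x (Or.inr hx), h, μd])
          rw [q₂C _ hx, q₂C _ (sameCycle_apply_right.2 hx), μf x (Or.inr hx),
            ← neg_sub, h, hanti x (Or.inr hx), neg_neg]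
      · rw [q₂N x hx, q₂N _ ((fO x).not.2 hx), f'N x hx]
    have dq₂c : q₂ (M.f c₀) - q₂ c₀ = -(q₂ (M.f d₀) - q₂ d₀) := by
      have h₁ : SameCycle M.f c₀ c₀ := SameCycle.refl _ _
      have h₂ : SameCycle M.f d₀ d₀ := SameCycle.refl _ _
      rw [q₂C _ h₁, q₂C _ (sameCycle_apply_right.2 h₁), μf _ Oc, μc, q₂D _ h₂,
        q₂D _ (sameCycle_apply_right.2 h₂)]
      ring
    obtain ⟨c, hc₁, hc₂⟩ := M.exact q₂ fun x => by
      by_cases hxd : x = d₀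
      · rw [hxd]; exact dq₂c
      by_cases hxc : x = c₀
      · rw [hxc, hec, dq₂c, neg_neg]
      rw [dq₂ x hxd hxc, dq₂ _ (fun h => hxc (by rw [hc₀, ← h, M.e_e]))
        (fun h => hxd (by rw [← M.e_e x, h, hec])), hq]
    have hcD : ∀ d x, SameCycle M.f d x → c x = c d := fun d x hx => by
      obtain ⟨k, rfl⟩ := hx.exists_nat_pow_eq
      clear hx
      induction k with
      | zero => rfl
      | succ k ih => rw [pow_succ', Equiv.Perm.mul_apply, hc₁, ih]
    have hcc : c c₀ = c d₀ := by
      have h₁ : SameCycle M.f d₀ d₀ := SameCycle.refl _ _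
      have h := hc₂ d₀
      rw [hc₁, ← hc₀, q₂C _ (SameCycle.refl _ _), μc, q₂D _ (sameCycle_apply_right.2 h₁)] at h
      linarith
    let p₂ : M.D → ℚ := fun x => q₂ x + c x
    have hp₂ : ∀ x, p₂ (M.e x) = p₂ (M.f x) := hc₂
    have hp₂C : ∀ x, SameCycle M.f c₀ x → p₂ x = p₂ (M.f (μ x)) := fun x hx => by
      have h := sameCycle_apply_right.2 (μ₂ x hx)
      simp only [p₂]
      rw [q₂C x hx, q₂D _ h, hcD _ _ hx, hcD _ _ h, hcc]
    have dp₂ : ∀ x, x ≠ d₀ → x ≠ c₀ → p₂ (M.f x) - p₂ x = q (f' x) - q x := fun x h h' => by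
      rw [← dq₂ x h h']
      simp only [p₂, hc₁]; ring
    let p : M.D → ℚ := fun x => if x = c₀ then p₂ d₀ + (q (f' d₀) - q d₀) else p₂ x
    have hpc : p c₀ = p₂ d₀ + (q (f' d₀) - q d₀) := if_pos rfl
    have hpN : ∀ x, x ≠ c₀ → p x = p₂ x := fun x hx => if_neg hx
    have hp : ∀ x, p (M.e x) = p (f' x) := by
      intro x
      by_cases hxd : x = d₀
      · rw [hxd, f'O _ Od, μd]
      have hex : M.e x ≠ c₀ := fun h => hxd (by rw [← M.e_e x, h, hec])
      rw [hpN _ hex, hp₂]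
      by_cases hx : O x
      · rw [f'O x hx, hpN _ fun h => hxd (by rw [← μμ x hx, h, μc])]
        rcases hx with hx | hx
        · rw [hp₂C _ (μ₁ x hx), μμ x (Or.inl hx)]
        · rw [hp₂C _ (sameCycle_apply_right.2 hx), μf x (Or.inr hx)]
      · rw [f'N x hx, hpN _ fun h => hx ((fO x).1 (by rw [h]; exact Oc))]
    have dp : ∀ x, p (f' x) - p x = q (f' x) - q x := by
      intro x
      by_cases hxd : x = d₀
      · rw [hxd]
        nth_rw 1 [f'O _ Od]
        rw [μd, hpc, hpN _ hdc]; ring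
      by_cases hxc : x = c₀
      · rw [hxc]
        have := hanti d₀ Od
        rw [μd] at this
        rw [this]
        nth_rw 1 [f'O _ Oc]
        rw [μc, hpc, hpN _ hdc]; ring
      rw [hpN x hxc]
      by_cases hx : O x
      · have hμx : μ x ≠ c₀ := fun h => hxd (by rw [← μμ x hx, h, μc])
        rw [← dp₂ x hxd hxc, f'O x hx, hpN _ hμx]
        rcases hx with hx | hx
        · rw [hp₂C _ (μ₁ x hx), μμ x (Or.inl hx)]
        · rw [hp₂C _ (sameCycle_apply_right.2 hx), μf x (Or.inr hx)]
      · rw [f'N x hx, hpN _ fun h => hx ((fO x).1 (by rw [h]; exact Oc)), ← f'N x hx,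
          ← dp₂ x hxd hxc, f'N x hx]
    refine ⟨fun x => p x - q x, fun x => ?_, fun x => ?_⟩
    · have := dp x
      change p (f' x) - q (f' x) = p x - q x
      linarith
    · change q (M.e x) + (p (M.e x) - q (M.e x)) = q (f' x) + (p (f' x) - q (f' x))
      rw [hp]; ring

end GSC


namespace GSC

open Function

variable {S : Type}

theorem lab_f_ne {P : C6Presentation S} {D : Type} [Finite D] {f : D → D} (hf : Injective f)
    {lab : D → S × Bool} {d : D} (h : faceWord f lab d ∈ P.rels) :
    lab (f d) ≠ letterInv (lab d) := by
  have hp := minimalPeriod_pos hf d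
  have hr := P.cyclically_reduced _ h
  have hr : List.IsChain _ (faceWord f lab d ++ faceWord f lab d) := hr
  rw [List.isChain_iff_getElem] at hr
  have h₁ := hr 0 (by simp; omega)
  have h0 : (faceWord f lab d ++ faceWord f lab d)[0]'(by simp; omega) = lab d := by
    rw [List.getElem_append_left (by simpa using hp), getElem_faceWord]; rfl
  have h1 : (faceWord f lab d ++ faceWord f lab d)[1]'(by simp; omega) = lab (f d) := by
    rcases (Nat.succ_le_of_lt hp).lt_or_eq with hlt | heq
    · rw [List.getElem_append_left (by simpa using hlt), getElem_faceWord]; rfl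
    · have hfd : f d = d := by
        have := iterate_minimalPeriod (f := f) (x := d)
        rwa [← heq] at this
      rw [List.getElem_append_right (by simp [← heq]), getElem_faceWord]
      simp [← heq, hfd]
  rw [ne_letterInv_iff]
  simpa only [zero_add, h0, h1] using h₁

/-- A diagram all of whose inner faces are relators, no two of which are mirror images of each
other across a common edge. -/
structure Diagram.IsReduced {P : C6Presentation S} {W : Word S} (M : Diagram P W) : Prop where
  mem_rels : ∀ d, ¬ M.InBase d → faceWord M.f M.lab d ∈ P.rels
  not_mirror : ∀ d, ¬ M.InBase d → ¬ M.InBase (M.e d) →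
    faceWord M.f M.lab d ≠ wordInv (faceWord M.f M.lab (M.f (M.e d)))

theorem lab_zpow_of_faceWord_eq_wordInv {D : Type} [Finite D] {f : Equiv.Perm D}
    {lab : D → S × Bool} {d c : D} (h : faceWord f lab d = wordInv (faceWord f lab (f c))) (k : ℤ) :
    lab ((f ^ k) d) = letterInv (lab ((f ^ (-k)) c)) := by
  have hlen : minimalPeriod f d = minimalPeriod f c := by
    have := congrArg List.length h
    rwa [length_wordInv, length_faceWord, length_faceWord,
      minimalPeriod_apply (f.injective.mem_periodicPts c)] at this
  set n := minimalPeriod f d with hn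
  have hpos : 0 < n := minimalPeriod_pos f.injective d
  obtain ⟨m, hm, hkm⟩ : ∃ m : ℕ, m < n ∧ (n : ℤ) ∣ k - m := by
    refine ⟨(k % n).toNat, ?_, ?_⟩
    · have h1 := Int.emod_lt_of_pos k (b := n) (by omega)
      have h2 := Int.emod_nonneg k (b := n) (by omega)
      omega
    · rw [Int.toNat_of_nonneg (Int.emod_nonneg k (by omega))]
      exact Int.dvd_self_sub_emod
  have h₁ : (f ^ k) d = f^[m] d := by
    rw [← zpow_eq_iterate, zpow_apply_eq_iff, ← hn]
    exact hkm
  have h₂ : (f ^ (-k)) c = f^[n - 1 - m] (f c) := by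
    rw [← iterate_succ_apply, ← zpow_eq_iterate, zpow_apply_eq_iff, ← hlen, ← dvd_neg]
    have h3 : ((n - 1 - m).succ : ℤ) = n - m := by omega
    rw [h3]
    obtain ⟨t, ht⟩ := hkm
    exact ⟨t + 1, by linarith⟩
  have hper : minimalPeriod f (f c) = n := by
    rw [hlen, minimalPeriod_apply (f.injective.mem_periodicPts c)]
  have h₃ : (faceWord f lab d)[m]? = (wordInv (faceWord f lab (f c)))[m]? := by rw [h]
  rw [wordInv_eq, List.getElem?_reverse (by simpa [hper] using hm), List.getElem?_map,
    List.length_map, length_faceWord, hper, List.getElem?_eq_getElem (by simpa using hm),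
    List.getElem?_eq_getElem (by simp [hper]; omega), getElem_faceWord, getElem_faceWord] at h₃
  rw [h₁, h₂]
  simpa using h₃

theorem Diagram.inBase_iff_of_sameCycle {P : C6Presentation S} {W : Word S} (M : Diagram P W)
    {x y : M.D} (h : M.f.SameCycle x y) : M.InBase x ↔ M.InBase y := by
  obtain ⟨k, rfl⟩ := h.exists_nat_pow_eq
  rw [← Equiv.Perm.iterate_eq_pow, M.inBase_iterate]

theorem exists_isReduced {P : C6Presentation S} {W : Word S} (h : Nonempty (Diagram P W)) :
    ∃ M : Diagram P W, M.IsReduced := by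
  classical
  obtain ⟨M, hM⟩ : ∃ M : Diagram P W, ∀ M' : Diagram P W, Fintype.card M.D ≤ Fintype.card M'.D := by
    obtain ⟨M, -, hM⟩ := WellFounded.has_min (measure fun M : Diagram P W => Fintype.card M.D).wf
      Set.univ ⟨h.some, trivial⟩
    exact ⟨M, fun M' => not_lt.1 (hM M' trivial)⟩
  have hrel : ∀ d, ¬ M.InBase d → faceWord M.f M.lab d ∈ P.rels := fun d hd => by
    rcases M.face d with h | h | ⟨h₁, h₂⟩
    · exact (hd h).elim
    · exact h
    · obtain ⟨M', hM'⟩ := M.exists_card_lt_of_digon rfl h₁ h₂ hd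
      exact absurd (hM M') (not_le.2 hM')
  refine ⟨M, hrel, fun d hd hc h => ?_⟩
  have hlab := lab_zpow_of_faceWord_eq_wordInv h
  obtain ⟨M', hM'⟩ := M.exists_digon_of_mirror (d₀ := d) (by
    have := congrArg List.length h
    rwa [length_wordInv, length_faceWord, length_faceWord,
      minimalPeriod_apply (M.f.injective.mem_periodicPts _)] at this) hlab (by
    rintro ⟨j, hj⟩
    rw [← hj] at hlab
    obtain ⟨m, rfl | rfl⟩ := Int.even_or_odd' j
    · have h₁ := hlab m
      rw [← Equiv.Perm.mul_apply, ← zpow_add, show -m + 2 * m = m by ring] at h₁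
      exact letterInv_ne _ h₁.symm
    · have h₁ := hlab (m + 1)
      rw [← Equiv.Perm.mul_apply, ← zpow_add, show -(m + 1) + (2 * m + 1) = m by ring, add_comm,
        zpow_one_add, Equiv.Perm.mul_apply] at h₁
      refine lab_f_ne M.f.injective (hrel _ ?_) h₁
      rwa [M.inBase_iff_of_sameCycle ⟨m, rfl⟩] at hd) hd hc
  exact absurd (hM M') (not_le.2 hM')

end GSC


namespace GSC

open Function

variable {S : Type}

/-! ### Euler's inequality -/

/-- The number of orbits of a permutation. -/
noncomputable def orbitCount {D : Type} (g : Equiv.Perm D) : ℕ :=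
  Nat.card (Quotient (Equiv.Perm.SameCycle.setoid g))

open Classical in
theorem mul_orbitCount_le {D : Type} [Fintype D] (g : Equiv.Perm D) (w : D → ℕ) (m : ℕ)
    (h : ∀ x, m ≤ ∑ y with g.SameCycle x y, w y) : m * orbitCount g ≤ ∑ y, w y := by
  have : Fintype (Quotient (Equiv.Perm.SameCycle.setoid g)) := Fintype.ofFinite _
  rw [orbitCount, Nat.card_eq_fintype_card,
    ← Finset.sum_fiberwise Finset.univ (Quotient.mk (Equiv.Perm.SameCycle.setoid g)) w, mul_comm,
    ← smul_eq_mul, ← Finset.card_univ]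
  refine Finset.card_nsmul_le_sum _ _ _ fun x _ => ?_
  induction x using Quotient.inductionOn with
  | h x =>
    refine (h x).trans_eq (Finset.sum_congr ?_ fun _ _ => rfl)
    ext y
    simp only [Finset.mem_filter, Finset.mem_univ, true_and]
    rw [eq_comm, Quotient.eq]
    rfl

/-- The functions invariant under a permutation. -/
def invariants {D : Type} (g : Equiv.Perm D) : Submodule ℚ (D → ℚ) where
  carrier := {p | ∀ d, p (g d) = p d}
  add_mem' {p q} hp hq d := by simp [hp d, hq d]
  zero_mem' d := rfl
  smul_mem' c p hp d := by simp [hp d]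

theorem one_mem_invariants {D : Type} (g : Equiv.Perm D) : (1 : D → ℚ) ∈ invariants g :=
  fun _ => rfl

theorem finrank_invariants_le {D : Type} [Finite D] (g : Equiv.Perm D) :
    Module.finrank ℚ (invariants g) ≤ orbitCount g := by
  have : Fintype (Quotient (Equiv.Perm.SameCycle.setoid g)) := Fintype.ofFinite _
  have hconst : ∀ p ∈ invariants g, ∀ x y, g.SameCycle x y → p x = p y := by
    intro p hp x y h
    obtain ⟨k, rfl⟩ := h.exists_nat_pow_eq
    clear h
    induction k with
    | zero => rfl
    | succ k ih => rw [pow_succ', Equiv.Perm.mul_apply, hp, ih]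
  let T : (Quotient (Equiv.Perm.SameCycle.setoid g) → ℚ) →ₗ[ℚ] (D → ℚ) :=
    LinearMap.funLeft ℚ ℚ (Quotient.mk _)
  have hle : invariants g ≤ LinearMap.range T := by
    intro p hp
    refine ⟨fun x => Quotient.lift p (hconst p hp) x, ?_⟩
    ext d
    rfl
  calc Module.finrank ℚ (invariants g) ≤ Module.finrank ℚ (LinearMap.range T) :=
        Submodule.finrank_mono hle
    _ ≤ Module.finrank ℚ (Quotient (Equiv.Perm.SameCycle.setoid g) → ℚ) :=
        LinearMap.finrank_range_le T
    _ = orbitCount g := by rw [Module.finrank_fintype_fun_eq_card, orbitCount,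
        Nat.card_eq_fintype_card]

variable {P : C6Presentation S} {W : Word S} (M : Diagram P W)

/-- The edge involution of a diagram as a permutation. -/
def Diagram.edgePerm : Equiv.Perm M.D := ⟨M.e, M.e, M.e_e, M.e_e⟩

theorem Diagram.two_mul_orbitCount_edgePerm_le :
    2 * orbitCount M.edgePerm ≤ Fintype.card M.D := by
  classical
  refine (mul_orbitCount_le M.edgePerm (fun _ => 1) 2 fun x => ?_).trans (by simp)
  calc 2 = ∑ y ∈ {x, M.e x}, 1 := by simp [(M.e_ne x).symm]
    _ ≤ _ := Finset.sum_le_sum_of_subset fun y hy => by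
        simp only [Finset.mem_insert, Finset.mem_singleton] at hy
        simp only [Finset.mem_filter, Finset.mem_univ, true_and]
        rcases hy with rfl | rfl
        · exact Equiv.Perm.SameCycle.refl _ _
        · exact ⟨1, rfl⟩

/-- Euler's inequality for planar diagrams. -/
theorem Diagram.card_add_four_le :
    Fintype.card M.D + 4 ≤ 2 * orbitCount (M.edgePerm.trans M.f) + 2 * orbitCount M.f := by
  let T : (M.D → ℚ) →ₗ[ℚ] (M.D → ℚ) :=
    { toFun := fun q d => (q (M.f d) - q d) + (q (M.f (M.e d)) - q (M.e d))
      map_add' := fun p q => by ext d; simp only [Pi.add_apply]; ring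
      map_smul' := fun c q => by
        ext d; simp only [Pi.smul_apply, smul_eq_mul, RingHom.id_apply]; ring }
  let A := invariants (M.edgePerm.trans M.f)
  let B := invariants M.f
  have hker : LinearMap.ker T ≤ A ⊔ B := by
    intro q hq
    obtain ⟨c, h₁, h₂⟩ := M.exact q fun d => by
      have : (q (M.f d) - q d) + (q (M.f (M.e d)) - q (M.e d)) = 0 := congrFun hq d
      linarith
    refine Submodule.mem_sup.2 ⟨fun d => q d + c d, fun d => ?_, fun d => - c d, fun d => ?_, ?_⟩
    · have := h₂ (M.e d)
      rw [M.e_e] at this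
      exact this.symm
    · exact congrArg Neg.neg (h₁ d)
    · ext d; simp
  have hone : (1 : M.D → ℚ) ≠ 0 := fun h => by simpa using congrFun h M.base
  have hinf : 1 ≤ Module.finrank ℚ ↥(A ⊓ B) :=
    Submodule.one_le_finrank_iff.2 fun h => hone <| by
      have : (1 : M.D → ℚ) ∈ A ⊓ B := ⟨one_mem_invariants _, one_mem_invariants _⟩
      rwa [h] at this
  have hsup := Submodule.finrank_sup_add_finrank_inf_eq A B
  have hA : Module.finrank ℚ A ≤ _ := finrank_invariants_le (M.edgePerm.trans M.f)
  have hB : Module.finrank ℚ B ≤ _ := finrank_invariants_le M.f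
  have hk := Submodule.finrank_mono hker
  have hsum : ∀ q, ∑ d, T q d = 0 := fun q => by
    have h₁ : ∑ d, q (M.f d) = ∑ d, q d := Equiv.sum_comp M.f q
    have h₂ : ∑ d, q (M.f (M.e d)) = ∑ d, q d := Equiv.sum_comp (M.edgePerm.trans M.f) q
    have h₃ : ∑ d, q (M.e d) = ∑ d, q d := Equiv.sum_comp M.edgePerm q
    change ∑ d, ((q (M.f d) - q d) + (q (M.f (M.e d)) - q (M.e d))) = 0
    rw [Finset.sum_add_distrib, Finset.sum_sub_distrib, Finset.sum_sub_distrib, h₁, h₂, h₃]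
    ring
  have hrange : LinearMap.range T < invariants M.edgePerm := by
    refine lt_of_le_of_ne ?_ fun h => ?_
    · rintro _ ⟨q, rfl⟩ d
      change (q (M.f (M.e d)) - q (M.e d)) + (q (M.f (M.e (M.e d))) - q (M.e (M.e d))) =
        (q (M.f d) - q d) + (q (M.f (M.e d)) - q (M.e d))
      rw [M.e_e]; ring
    · have h1 : (1 : M.D → ℚ) ∈ LinearMap.range T := h ▸ one_mem_invariants _
      obtain ⟨q, hq⟩ := h1
      have := hsum q
      rw [hq] at this
      have hc : (Fintype.card M.D : ℚ) = 0 := by simpa using this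
      have : 0 < Fintype.card M.D := Fintype.card_pos_iff.2 ⟨M.base⟩
      exact absurd hc (by positivity)
  have hr := Submodule.finrank_lt_finrank_of_lt hrange
  have he := finrank_invariants_le M.edgePerm
  have he2 := M.two_mul_orbitCount_edgePerm_le
  have hrk := LinearMap.finrank_range_add_finrank_ker T
  rw [Module.finrank_fintype_fun_eq_card] at hrk
  omega

end GSC


namespace GSC

open Function

variable {S : Type}

/-! ### Local structure of reduced diagrams -/

namespace Diagram

variable {P : C6Presentation S} {W : Word S} (M : Diagram P W)

theorem minimalPeriod_base : minimalPeriod M.f M.base = W.length := by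
  rw [← length_faceWord M.f M.lab, M.base_word]

theorem lab_iterate_base (k : ℕ) (hk : k < W.length) : M.lab (M.f^[k] M.base) = W[k] := by
  have h := getElem_faceWord M.f M.lab M.base k (by rwa [length_faceWord, minimalPeriod_base])
  rw [← h]
  exact getElem_congr_coll M.base_word

theorem pos_iterate_base (k : ℕ) (hk : k ≤ W.length) :
    M.pos (M.f^[k] M.base) = M.pos M.base * P.elt (W.take k) := by
  induction k with
  | zero => simp
  | succ k ih =>
    rw [iterate_succ_apply', M.pos_f, ih (by omega), M.lab_iterate_base k hk,
      elt_take_succ P W k hk, mul_assoc]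

theorem exists_iterate_base {x : M.D} (hx : M.InBase x) :
    ∃ k < W.length, M.f^[k] M.base = x := by
  obtain ⟨k, rfl⟩ := hx
  have := minimalPeriod_pos M.f.injective M.base
  rw [M.minimalPeriod_base] at this
  refine ⟨k % W.length, Nat.mod_lt _ this, ?_⟩
  rw [← M.minimalPeriod_base, iterate_mod_minimalPeriod_eq]

/-- The boundary word of the diagram traces a simple closed path. -/
def _root_.GSC.IsSimple (P : C6Presentation S) (W : Word S) : Prop :=
  ∀ i j, i < j → j < W.length → P.elt (W.take i) ≠ P.elt (W.take j)

variable {M}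

theorem eq_of_pos_eq (hW : IsSimple P W) {x y : M.D} (hx : M.InBase x) (hy : M.InBase y)
    (h : M.pos x = M.pos y) : x = y := by
  obtain ⟨k, hk, rfl⟩ := M.exists_iterate_base hx
  obtain ⟨l, hl, rfl⟩ := M.exists_iterate_base hy
  rw [M.pos_iterate_base k hk.le, M.pos_iterate_base l hl.le] at h
  have h := mul_left_cancel h
  rcases lt_trichotomy k l with hkl | rfl | hkl
  · exact absurd h (hW k l hkl hl)
  · rfl
  · exact absurd h.symm (hW l k hkl hk)

theorem f_e_ne (hM : M.IsReduced) (hW : IsSimple P W) (hW2 : ∀ x, W ≠ [x, letterInv x]) (d : M.D) :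
    M.f (M.e d) ≠ d := by
  intro h
  obtain ⟨c, hc⟩ : ∃ c, M.e d = c := ⟨_, rfl⟩
  have hlab : M.lab (M.f c) = letterInv (M.lab c) := by rw [← hc, h, ← M.lab_e, M.e_e]
  by_cases hb : M.InBase c
  · have hff : M.f (M.f c) = c := by
      refine eq_of_pos_eq hW ?_ hb ?_
      · rwa [M.inBase_f, M.inBase_f]
      · rw [M.pos_f, M.pos_f, hlab, letter_letterInv, mul_inv_cancel_right]
    clear hc
    obtain ⟨k, hk, rfl⟩ := M.exists_iterate_base hb
    have h2 : minimalPeriod M.f (M.f^[k] M.base) ∣ 2 := by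
      rw [← isPeriodicPt_iff_minimalPeriod_dvd]
      exact hff
    rw [minimalPeriod_apply_iterate (M.f.injective.mem_periodicPts _), M.minimalPeriod_base] at h2
    rcases (Nat.dvd_prime Nat.prime_two).1 h2 with h1 | h2
    · obtain rfl : k = 0 := by omega
      have h1 : M.f M.base = M.base := by
        have := iterate_minimalPeriod (f := M.f) (x := M.base)
        rwa [M.minimalPeriod_base, h1] at this
      rw [iterate_zero, id, h1] at hlab
      exact letterInv_ne _ hlab.symm
    · obtain ⟨a, b, hab⟩ := List.length_eq_two.1 h2
      have ha : M.lab M.base = a := by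
        rw [← iterate_zero_apply M.f M.base, M.lab_iterate_base 0 (by omega)]; simp [hab]
      have hb' : M.lab (M.f M.base) = b := by
        rw [← iterate_one M.f, M.lab_iterate_base 1 (by omega)]; simp [hab]
      have hf2 : M.f (M.f M.base) = M.base := by
        have := iterate_minimalPeriod (f := M.f) (x := M.base)
        rwa [M.minimalPeriod_base, h2] at this
      obtain rfl | rfl : k = 0 ∨ k = 1 := by omega
      · rw [iterate_zero, id, ha, hb'] at hlab
        exact hW2 a (by rw [hab, hlab])
      · rw [iterate_one, hf2, ha, hb'] at hlab
        exact hW2 a (by rw [hab, hlab, letterInv_letterInv])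
  · exact lab_f_ne M.f.injective (hM.mem_rels c hb) hlab

variable (M) in
/-- The terminal vertex of `x` has degree two. -/
def Smooth (x : M.D) : Prop := M.f (M.e (M.f x)) = M.e x

open Classical in
theorem card_not_smooth_add_le (hM : M.IsReduced) (hW : IsSimple P W)
    (hW2 : ∀ x, W ≠ [x, letterInv x]) :
    Fintype.card {x // ¬ M.Smooth x} + 12 ≤ 6 * orbitCount M.f := by
  obtain ⟨σ, hσ⟩ : ∃ σ : Equiv.Perm M.D, σ = M.edgePerm.trans M.f := ⟨_, rfl⟩
  have σd : ∀ d, σ d = M.f (M.e d) := fun d => by rw [hσ]; rfl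
  have hV := mul_orbitCount_le σ (fun d => if σ (σ d) = d then 3 else 2) 6 fun x => by
    have h₁ : σ x ≠ x := σd x ▸ f_e_ne hM hW hW2 x
    have h₂ : σ (σ x) ≠ σ x := σd (σ x) ▸ f_e_ne hM hW hW2 (σ x)
    have c₁ : σ.SameCycle x (σ x) := ⟨1, rfl⟩
    have c₂ : σ.SameCycle x (σ (σ x)) := ⟨2, rfl⟩
    by_cases h : σ (σ x) = x
    · calc 6 = ∑ y ∈ {x, σ x}, if σ (σ y) = y then 3 else 2 := by
            rw [Finset.sum_pair h₁.symm]; simp [h]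
        _ ≤ _ := Finset.sum_le_sum_of_subset fun y hy => by
            simp only [Finset.mem_insert, Finset.mem_singleton] at hy
            simp only [Finset.mem_filter, Finset.mem_univ, true_and]
            rcases hy with rfl | rfl
            exacts [Equiv.Perm.SameCycle.refl _ _, c₁]
    · calc 6 = ∑ y ∈ {x, σ x, σ (σ x)}, 2 := by
            rw [Finset.sum_const, Finset.card_eq_three.2
              ⟨x, σ x, σ (σ x), h₁.symm, Ne.symm h, h₂.symm, rfl⟩]; rfl
        _ ≤ ∑ y ∈ {x, σ x, σ (σ x)}, if σ (σ y) = y then 3 else 2 :=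
            Finset.sum_le_sum fun y _ => by split_ifs <;> omega
        _ ≤ _ := Finset.sum_le_sum_of_subset fun y hy => by
            simp only [Finset.mem_insert, Finset.mem_singleton] at hy
            simp only [Finset.mem_filter, Finset.mem_univ, true_and]
            rcases hy with rfl | rfl | rfl
            exacts [Equiv.Perm.SameCycle.refl _ _, c₁, c₂]
  have hcount : ∑ d, (if σ (σ d) = d then 3 else 2) + Fintype.card {x // ¬ M.Smooth x} =
      3 * Fintype.card M.D := by
    have h₁ : ∑ d, (if σ (σ d) = d then 3 else 2) =
        ∑ d, if σ (σ (M.f d)) = M.f d then 3 else 2 :=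
      (Equiv.sum_comp M.f fun d => if σ (σ d) = d then 3 else 2).symm
    have h₂ : ∀ d, σ (σ (M.f d)) = M.f d ↔ M.Smooth d := fun d => by
      rw [σd, σd, M.f.injective.eq_iff, Smooth]
      exact ⟨fun h => by rw [← M.e_e (M.f (M.e (M.f d))), h], fun h => by rw [h, M.e_e]⟩
    rw [h₁, Fintype.card_subtype, Finset.card_filter, ← Finset.sum_add_distrib]
    simp only [h₂]
    rw [Finset.sum_congr rfl (g := fun _ => 3) fun d _ => by by_cases h : M.Smooth d <;> simp [h]]
    simp [mul_comm]
  have := M.card_add_four_le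
  rw [← hσ] at this
  omega

/-- Consecutive edges on the base face meet in a vertex of degree two. -/
theorem smooth_of_inBase (hW : IsSimple P W) {x : M.D} (hx : M.InBase (M.e x))
    (hfx : M.InBase (M.e (M.f x))) : M.Smooth x := by
  refine eq_of_pos_eq hW ((M.inBase_f _).2 hfx) hx ?_
  rw [← M.pos_e_eq, M.e_e, ← M.pos_e_eq]

/-- Along smooth vertices the neighbouring face runs backwards. -/
theorem iterate_e_iterate {x : M.D} {m : ℕ} (h : ∀ k < m, M.Smooth (M.f^[k] x)) :
    M.f^[m] (M.e (M.f^[m] x)) = M.e x := by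
  induction m with
  | zero => rfl
  | succ m ih =>
    rw [iterate_succ_apply, iterate_succ_apply' _ m x, h m (by omega),
      ih fun k hk => h k (by omega)]

theorem inBase_e_iterate {x : M.D} {m : ℕ} (h : ∀ k < m, M.Smooth (M.f^[k] x)) :
    M.InBase (M.e (M.f^[m] x)) ↔ M.InBase (M.e x) := by
  rw [← iterate_e_iterate h, M.inBase_iterate]

theorem minimalPeriod_f (x : M.D) : minimalPeriod M.f (M.f x) = minimalPeriod M.f x :=
  minimalPeriod_apply (M.f.injective.mem_periodicPts x)

/-- The inverse of the word of the face across `d`, read along `d`. -/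
theorem getElem_wordInv_faceWord {c : M.D} {k : ℕ} {y : M.D} (hy : M.f^[k] y = c)
    (hk : k < (wordInv (faceWord M.f M.lab (M.f c))).length) :
    (wordInv (faceWord M.f M.lab (M.f c)))[k] = letterInv (M.lab y) := by
  have hk' := hk
  rw [length_wordInv, length_faceWord, minimalPeriod_f] at hk'
  simp only [wordInv_eq, List.getElem_reverse, List.getElem_map, List.length_map,
    getElem_faceWord, length_faceWord, minimalPeriod_f]
  congr 2
  have hper : minimalPeriod M.f y = minimalPeriod M.f c := by
    rw [← hy, minimalPeriod_apply_iterate (M.f.injective.mem_periodicPts _)]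
  rw [← hy, hy, ← hper, ← iterate_succ_apply, ← hy, ← iterate_add_apply,
    show (minimalPeriod M.f y - 1 - k).succ + k = minimalPeriod M.f y by omega,
    iterate_minimalPeriod]

/-- Two inner faces meet in a piece. -/
theorem six_mul_lt (hM : M.IsReduced) {d : M.D} (hd : ¬ M.InBase d) (he : ¬ M.InBase (M.e d))
    {m : ℕ} (hm : m ≤ minimalPeriod M.f d) (h : ∀ k, k + 1 < m → M.Smooth (M.f^[k] d)) :
    6 * m < minimalPeriod M.f d := by
  set R₁ := faceWord M.f M.lab d with hR₁
  set R₂ := wordInv (faceWord M.f M.lab (M.f (M.e d))) with hR₂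
  have h₁ : R₁ ∈ P.rels := hM.mem_rels d hd
  have h₂ : R₂ ∈ P.rels := P.inv_mem _ (hM.mem_rels _ (by rwa [M.inBase_f]))
  have hne : R₁ ≠ R₂ := hM.not_mirror d hd he
  have hl₁ : R₁.length = minimalPeriod M.f d := length_faceWord _ _ _
  have hl₂ : 0 < R₂.length := by
    rw [hR₂, length_wordInv, length_faceWord]
    exact minimalPeriod_pos M.f.injective _
  set m' := min m R₂.length with hm'
  have htake : R₁.take m' = R₂.take m' := by
    refine List.ext_getElem (by simp; omega) fun k hk₁ hk₂ => ?_
    rw [List.length_take] at hk₁ hk₂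
    rw [List.getElem_take, List.getElem_take, getElem_faceWord,
      getElem_wordInv_faceWord (iterate_e_iterate fun j hj => h j (by omega)), M.lab_e,
      letterInv_letterInv]
  have hp : IsPiece P.rels (R₁.take m') :=
    ⟨R₁, h₁, R₂, h₂, hne, List.take_prefix _ _, htake ▸ List.take_prefix _ _⟩
  have hs₁ := P.small_cancellation R₁ h₁ _ (List.take_prefix _ _) hp
  have hs₂ := P.small_cancellation R₂ h₂ _ (htake ▸ List.take_prefix m' R₂) hp
  rw [List.length_take] at hs₁ hs₂
  omega

end Diagram

end GSC


namespace GSC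

open Function

variable {S : Type}

/-! ### Curvature of a face -/

section Orbit

variable {D : Type} [Fintype D] {f : Equiv.Perm D}

theorem exists_iterate_of_sameCycle {x y : D} (h : f.SameCycle x y) :
    ∃ k < minimalPeriod f x, f^[k] x = y := by
  obtain ⟨k, hk⟩ := h.exists_nat_pow_eq
  refine ⟨k % minimalPeriod f x, Nat.mod_lt _ (minimalPeriod_pos f.injective x), ?_⟩
  rw [iterate_mod_minimalPeriod_eq, ← hk, Equiv.Perm.iterate_eq_pow]

theorem sameCycle_iterate {D : Type} {f : Equiv.Perm D} (x : D) (k : ℕ) : f.SameCycle x (f^[k] x) :=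
  ⟨k, by rw [zpow_natCast, Equiv.Perm.iterate_eq_pow]⟩

open Classical in
theorem minimalPeriod_le_card_sameCycle (x : D) :
    minimalPeriod f x ≤ (Finset.univ.filter (f.SameCycle x)).card := by
  rw [← Finset.card_range (minimalPeriod f x)]
  refine Finset.card_le_card_of_injOn (fun k => f^[k] x) ?_ ?_
  · intro k _
    simpa using sameCycle_iterate x k
  · intro k hk l hl h
    simp only [Finset.coe_range, Set.mem_Iio] at hk hl
    exact (iterate_eq_iterate_iff_of_lt_minimalPeriod hk hl).1 h

open Classical in
/-- The possible patterns of a cyclic sequence of darts, each of which is exposed (`Ex`) or not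
and each of which is followed by a vertex of degree two (`Sm`) or not, subject to the small
cancellation condition. -/
theorem orbit_pattern (Sm Ex : D → Prop) (x : D)
    (hsmall : ∀ y, f.SameCycle x y → ¬ Ex y → ∀ m ≤ minimalPeriod f x,
      (∀ k, k + 1 < m → Sm (f^[k] y)) → 6 * m < minimalPeriod f x)
    (hcorner : ∀ y, Ex y → ¬ Sm y → ¬ Ex (f y))
    (hsm : ∀ y, Sm y → (Ex (f y) ↔ Ex y))
    {i j : ℕ} (hi : i = (Finset.univ.filter fun y => f.SameCycle x y ∧ ¬ Sm y ∧ ¬ Ex y).card)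
    (hj : j = (Finset.univ.filter fun y => f.SameCycle x y ∧ ¬ Sm y ∧ Ex y).card) :
    (∀ y, f.SameCycle x y → Sm y ∧ Ex y) ∨ 6 ≤ i + 2 * j ∨
    (1 ≤ j ∧ 1 ≤ i ∧ i ≤ 3 ∧ ∃ v, f.SameCycle x v ∧ ∃ m < minimalPeriod f x,
      (∀ k ≤ m, Ex (f^[k] v)) ∧ (∀ k < m, Sm (f^[k] v)) ∧
      (6 - i) * minimalPeriod f x < 6 * (m + 1)) := by
  set n := minimalPeriod f x with hn
  have hn0 : 0 < n := minimalPeriod_pos f.injective x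
  have hper : ∀ y, f.SameCycle x y → minimalPeriod f y = n := by
    intro y hy
    obtain ⟨k, -, rfl⟩ := exists_iterate_of_sameCycle hy
    exact minimalPeriod_apply_iterate (f.injective.mem_periodicPts _) k
  have hOit : ∀ y k, f.SameCycle x y → f.SameCycle x (f^[k] y) := fun y k hy =>
    hy.trans (sameCycle_iterate y k)
  have hOex : ∀ y z, f.SameCycle x y → f.SameCycle x z → ∃ k < n, f^[k] y = z := by
    intro y z hy hz
    rw [← hper y hy]
    exact exists_iterate_of_sameCycle (hy.symm.trans hz)
  have hrun : ∀ y k, (∀ l < k, Sm (f^[l] y)) → (Ex (f^[k] y) ↔ Ex y) := by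
    intro y k
    induction k with
    | zero => simp
    | succ k ih =>
      intro h
      rw [iterate_succ_apply', hsm _ (h k (by omega)), ih fun l hl => h l (by omega)]
  -- every unexposed dart runs into an unexposed corner
  have hun : ∀ y, f.SameCycle x y → ¬ Ex y → ∃ k, 6 * (k + 1) < n ∧ ¬ Sm (f^[k] y) ∧
      ∀ l ≤ k, ¬ Ex (f^[l] y) := by
    intro y hy he
    have h : ∃ k, ¬ Sm (f^[k] y) := by
      by_contra! h
      have := hsmall y hy he n le_rfl fun k _ => h k
      omega
    have hlt : ∀ l < Nat.find h, Sm (f^[l] y) := fun l hl => not_not.1 (Nat.find_min h hl)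
    refine ⟨Nat.find h, ?_, Nat.find_spec h, fun l hl => ?_⟩
    · by_cases hle : Nat.find h + 1 ≤ n
      · exact hsmall y hy he _ hle fun k hk => hlt k (by omega)
      · have := hsmall y hy he n le_rfl fun k hk => hlt k (by omega)
        omega
    · rwa [hrun y l fun k hk => hlt k (by omega)]
  set A := Finset.univ.filter fun y => f.SameCycle x y ∧ ¬ Sm y ∧ ¬ Ex y with hA
  set B := Finset.univ.filter fun y => f.SameCycle x y ∧ ¬ Sm y ∧ Ex y with hB
  have memA : ∀ y, y ∈ A ↔ f.SameCycle x y ∧ ¬ Sm y ∧ ¬ Ex y := by simp [hA]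
  have memB : ∀ y, y ∈ B ↔ f.SameCycle x y ∧ ¬ Sm y ∧ Ex y := by simp [hB]
  set U := Finset.univ.filter fun y => f.SameCycle x y ∧ ¬ Ex y with hU
  have hUcard : 6 * U.card ≤ i * (n - 1) := by
    have hsub : U ⊆ A.biUnion fun z =>
        (Finset.range ((n - 1) / 6)).image fun k => f.symm^[k] z := by
      intro y hy
      simp only [hU, Finset.mem_filter, Finset.mem_univ, true_and] at hy
      obtain ⟨k, hk, hs, he⟩ := hun y hy.1 hy.2
      simp only [Finset.mem_biUnion, Finset.mem_image, Finset.mem_range]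
      exact ⟨f^[k] y, (memA _).2 ⟨hOit y k hy.1, hs, he k le_rfl⟩, k, by omega,
        LeftInverse.iterate f.symm_apply_apply k y⟩
    have h := (Finset.card_le_card hsub).trans (Finset.card_biUnion_le_card_mul _ _ ((n - 1) / 6)
      fun z _ => Finset.card_image_le.trans (Finset.card_range _).le)
    rw [← hi] at h
    calc 6 * U.card ≤ 6 * (i * ((n - 1) / 6)) := by omega
      _ = i * (6 * ((n - 1) / 6)) := by ring
      _ ≤ _ := Nat.mul_le_mul_left _ (Nat.mul_div_le _ _)
  have hij : j ≤ i := by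
    have h : ∀ y ∈ B, ∃ k, 6 * (k + 1) < n ∧ ¬ Sm (f^[k] (f y)) ∧ ∀ l ≤ k, ¬ Ex (f^[l] (f y)) := by
      intro y hy
      rw [memB] at hy
      exact hun _ (hOit y 1 hy.1) (hcorner y hy.2.2 hy.2.1)
    choose! k _ hks hke using h
    rw [hi, hj]
    have key : ∀ y ∈ B, ∀ z ∈ B, k y ≤ k z → f^[k y] (f y) = f^[k z] (f z) → y = z := by
      intro y hy z hz hle heq
      obtain ⟨d, hd⟩ := Nat.exists_eq_add_of_le hle
      rw [hd, iterate_add_apply] at heq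
      have heq := f.injective.iterate _ heq
      cases d with
      | zero => exact f.injective heq
      | succ d =>
        rw [iterate_succ_apply'] at heq
        have := hke z hz d (by omega)
        rw [← f.injective heq] at this
        exact absurd ((memB _).1 hy).2.2 this
    refine Finset.card_le_card_of_injOn (fun y => f^[k y] (f y)) ?_ ?_
    · intro y hy
      exact (memA _).2 ⟨hOit _ _ (hOit y 1 ((memB _).1 hy).1), hks y hy, hke y hy _ le_rfl⟩
    · intro y hy z hz h
      rcases le_total (k y) (k z) with hle | hle
      · exact key y hy z hz hle h
      · exact (key z hz y hy hle h.symm).symm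
  by_cases hall : ∀ y, f.SameCycle x y → Ex y
  · refine Or.inl fun y hy => ⟨?_, hall y hy⟩
    by_contra hs
    exact hcorner y (hall y hy) hs (hall _ (hOit y 1 hy))
  · right
    push Not at hall
    obtain ⟨u, hu, heu⟩ := hall
    have hi1 : 1 ≤ i := by
      obtain ⟨k, -, hs, he⟩ := hun u hu heu
      rw [hi]
      exact Finset.card_pos.2 ⟨f^[k] u, (memA _).2 ⟨hOit u k hu, hs, he k le_rfl⟩⟩
    -- every exposed dart runs into an exposed corner
    have hex : ∀ y, f.SameCycle x y → Ex y → ∃ k, f^[k] y ∈ B ∧ (∀ l ≤ k, Ex (f^[l] y)) ∧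
        ∀ l < k, Sm (f^[l] y) := by
      intro y hy he
      have h : ∃ k, ¬ Sm (f^[k] y) := by
        by_contra! h
        obtain ⟨k, -, hk⟩ := hOex y u hy hu
        rw [← hk, hrun y k fun l _ => h l] at heu
        exact heu he
      have hlt : ∀ l < Nat.find h, Sm (f^[l] y) := fun l hl => not_not.1 (Nat.find_min h hl)
      have hall : ∀ l ≤ Nat.find h, Ex (f^[l] y) := fun l hl => by
        rwa [hrun y l fun k hk => hlt k (by omega)]
      exact ⟨Nat.find h, (memB _).2 ⟨hOit y _ hy, Nat.find_spec h, hall _ le_rfl⟩, hall, hlt⟩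
    have hcount : n ≤ U.card +
        (Finset.univ.filter fun y => f.SameCycle x y ∧ Ex y).card := by
      refine (minimalPeriod_le_card_sameCycle x).trans ?_
      rw [← Finset.card_filter_add_card_filter_not (s := Finset.univ.filter (f.SameCycle x)) Ex,
        Finset.filter_filter, Finset.filter_filter, add_comm]
    by_cases hi6 : 6 ≤ i + 2 * j
    · exact Or.inl hi6
    right
    have hj1 : j = 1 := by
      by_contra hne
      have hj0 : j = 0 := by omega
      have hB0 : B = ∅ := Finset.card_eq_zero.1 (hj ▸ hj0)
      have h0 : (Finset.univ.filter fun y => f.SameCycle x y ∧ Ex y) = ∅ := by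
        refine Finset.filter_eq_empty_iff.2 fun y _ hy => ?_
        obtain ⟨k, hk, -⟩ := hex y hy.1 hy.2
        simp [hB0] at hk
      rw [h0, Finset.card_empty] at hcount
      have : i * (n - 1) ≤ 6 * (n - 1) := Nat.mul_le_mul_right _ (by omega)
      omega
    obtain ⟨y, hy⟩ := Finset.card_eq_one.1 (hj ▸ hj1)
    have hyB : y ∈ B := hy ▸ Finset.mem_singleton_self y
    refine ⟨by omega, hi1, by omega, ?_⟩
    -- the start of the exposed run
    obtain ⟨v, hv, hev, hpv⟩ : ∃ v, f.SameCycle x v ∧ Ex v ∧ ∀ w, f w = v → ¬ Ex w := by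
      have hyO := ((memB y).1 hyB)
      have h : ∃ k, Ex (f^[k] u) := by
        obtain ⟨k, -, hk⟩ := hOex u y hu hyO.1
        exact ⟨k, hk ▸ hyO.2.2⟩
      refine ⟨f^[Nat.find h] u, hOit u _ hu, Nat.find_spec h, fun w hw hew => ?_⟩
      obtain ⟨k, hk⟩ := Nat.exists_eq_succ_of_ne_zero
        (show Nat.find h ≠ 0 from fun h0 => heu (by simpa [h0] using Nat.find_spec h))
      rw [hk, iterate_succ_apply'] at hw
      rw [f.injective hw] at hew
      exact Nat.find_min h (by omega) hew
    obtain ⟨m, hmB, hme, hms⟩ := hex v hv hev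
    have hmy : f^[m] v = y := by rwa [hy, Finset.mem_singleton] at hmB
    refine ⟨v, hv, m, ?_, hme, hms, ?_⟩
    · by_contra hle
      obtain ⟨k, hk, hku⟩ := hOex v u hv hu
      exact heu (hku ▸ hme k (by omega))
    · have hsub : (Finset.univ.filter fun y => f.SameCycle x y ∧ Ex y) ⊆
          (Finset.range (m + 1)).image fun k => f^[k] v := by
        intro z hz
        simp only [Finset.mem_filter, Finset.mem_univ, true_and] at hz
        obtain ⟨k, hkB, hke, -⟩ := hex z hz.1 hz.2
        have hky : f^[k] z = f^[m] v := by rwa [hy, Finset.mem_singleton, ← hmy] at hkB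
        simp only [Finset.mem_image, Finset.mem_range]
        rcases le_or_gt k m with hle | hlt
        · obtain ⟨d, rfl⟩ := Nat.exists_eq_add_of_le hle
          rw [iterate_add_apply] at hky
          exact ⟨d, by omega, (f.injective.iterate _ hky).symm⟩
        · obtain ⟨d, rfl⟩ := Nat.exists_eq_add_of_lt hlt
          rw [add_assoc, iterate_add_apply] at hky
          have hky := f.injective.iterate _ hky
          rw [iterate_succ_apply'] at hky
          exact absurd (hke d (by omega)) (hpv _ hky)
      have hE := (Finset.card_le_card hsub).trans
        (Finset.card_image_le.trans (Finset.card_range _).le)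
      have hi3 : i ≤ 3 := by omega
      clear_value n
      interval_cases i <;> omega

end Orbit

end GSC


namespace GSC

open Function

variable {S : Type} {P : C6Presentation S} {W : Word S}

/-! ### Greendlinger's lemma for simple closed words -/

namespace Diagram

variable {M : Diagram P W}

/-- A face all of whose edges are on the boundary fills the diagram. -/
theorem mem_rels_of_forall_smooth (hM : M.IsReduced) {x : M.D} (hx : ¬ M.InBase x)
    (h : ∀ k, M.Smooth (M.f^[k] x)) (he : M.InBase (M.e x)) : W ∈ P.rels := by
  have hbase : ∀ y, M.InBase y → minimalPeriod M.f y = W.length := by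
    rintro _ ⟨k, rfl⟩
    rw [minimalPeriod_apply_iterate (M.f.injective.mem_periodicPts _), M.minimalPeriod_base]
  have hit : ∀ m, M.f^[m] (M.e (M.f^[m] x)) = M.e x := fun m => iterate_e_iterate fun k _ => h k
  have heq : minimalPeriod M.f x = W.length := by
    refine Nat.dvd_antisymm ?_ ?_
    · rw [← isPeriodicPt_iff_minimalPeriod_dvd]
      have hb : M.InBase (M.e (M.f^[W.length] x)) := (inBase_e_iterate fun k _ => h k).2 he
      have h1 : M.f^[W.length] (M.e (M.f^[W.length] x)) = M.e (M.f^[W.length] x) :=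
        isPeriodicPt_iff_minimalPeriod_dvd.2 (hbase _ hb).dvd
      rw [hit] at h1
      have h2 := congrArg M.e h1
      rw [M.e_e, M.e_e] at h2
      exact h2.symm
    · rw [← hbase _ he, ← isPeriodicPt_iff_minimalPeriod_dvd]
      have h1 := hit (minimalPeriod M.f x)
      rwa [iterate_minimalPeriod] at h1
  have hword : faceWord M.f M.lab x = wordInv (faceWord M.f M.lab (M.f (M.e x))) := by
    refine List.ext_getElem ?_ fun k hk₁ hk₂ => ?_
    · rw [length_wordInv, length_faceWord, length_faceWord, minimalPeriod_f, hbase _ he, heq]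
    · rw [getElem_faceWord, getElem_wordInv_faceWord (hit k), M.lab_e, letterInv_letterInv]
  have hrel : faceWord M.f M.lab (M.f (M.e x)) ∈ P.rels := by
    rw [← wordInv_wordInv (faceWord M.f M.lab (M.f (M.e x))), ← hword]
    exact P.inv_mem _ (hM.mem_rels x hx)
  obtain ⟨k, hk⟩ := he
  rw [← hk, ← iterate_succ_apply' M.f k, faceWord_iterate M.f.injective, M.base_word] at hrel
  have := P.rotate_mem _ hrel ((k + 1) * (W.length - 1))
  rw [List.rotate_rotate, ← mul_one_add] at this
  rcases Nat.eq_zero_or_pos W.length with h0 | h0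
  · simpa [List.length_eq_zero_iff.1 h0] using this
  · rwa [show 1 + (W.length - 1) = W.length by omega, mul_comm, List.rotate_length_mul] at this

/-- A run of exposed edges of a face is a common subword of the boundary and of a relator. -/
theorem take_drop_prefix_of_run {v : M.D} {m s : ℕ} (hs : M.f^[s] M.base = M.e (M.f^[m] v))
    (hsm : ∀ k < m, M.Smooth (M.f^[k] v)) (hm : m < minimalPeriod M.f v) 
    (hle : s + (m + 1) ≤ W.length) :
    (W.drop s).take (m + 1) <+: wordInv (faceWord M.f M.lab (M.f (M.f^[m] v))) := by
  have hlen : (wordInv (faceWord M.f M.lab (M.f (M.f^[m] v)))).length = minimalPeriod M.f v := by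
    rw [length_wordInv, length_faceWord, minimalPeriod_f,
      minimalPeriod_apply_iterate (M.f.injective.mem_periodicPts _)]
  rw [List.prefix_iff_getElem]
  refine ⟨by rw [hlen, List.length_take]; omega, fun t ht => ?_⟩
  rw [List.length_take, List.length_drop] at ht
  rw [List.getElem_take, List.getElem_drop,
    getElem_wordInv_faceWord (y := M.f^[m - t] v)
      (by rw [← iterate_add_apply, Nat.add_sub_cancel' (by omega)]),
    ← M.lab_iterate_base (s + t) (by omega), ← M.lab_e, add_comm, iterate_add_apply, hs]
  congr 1
  have := iterate_e_iterate (x := M.f^[m - t] v) (m := t) fun k hk => by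
    rw [← iterate_add_apply]; exact hsm _ (by omega)
  rwa [← iterate_add_apply, Nat.add_sub_cancel' (by omega)] at this

open Classical in
/-- A marking `K` of the boundary compensates the curvature of a face with a long exposed run. -/
theorem curvature_le (hM : M.IsReduced) (hW : IsSimple P W) (K : Finset ℕ) (hWr : W ∉ P.rels)
    (hshell : ∀ s m i r', r' ∈ P.rels → s + m ≤ W.length → (W.drop s).take m <+: r' → 1 ≤ i →
      i ≤ 3 → (6 - i) * r'.length < 6 * m → 4 - i ≤ (K.filter fun k => s < k ∧ k < s + m).card)
    {x : M.D} (hx : ¬ M.InBase x) :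
    6 ≤ (Finset.univ.filter fun y => M.f.SameCycle x y ∧ ¬ M.Smooth y ∧ ¬ M.InBase (M.e y)).card +
      2 * (Finset.univ.filter fun y => M.f.SameCycle x y ∧ ¬ M.Smooth y ∧ M.InBase (M.e y)).card +
      (if M.f.SameCycle x (M.e M.base) then 3 else 0) +
      (K.filter fun k => M.f.SameCycle x (M.e (M.f^[k] M.base))).card := by
  have hin : ∀ y, M.f.SameCycle x y → ¬ M.InBase y := fun y hy => by
    rwa [← M.inBase_iff_of_sameCycle hy]
  have hper : ∀ y, M.f.SameCycle x y → minimalPeriod M.f y = minimalPeriod M.f x := by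
    intro y hy
    obtain ⟨k, -, rfl⟩ := exists_iterate_of_sameCycle hy
    exact minimalPeriod_apply_iterate (M.f.injective.mem_periodicPts _) k
  rcases orbit_pattern M.Smooth (fun y => M.InBase (M.e y)) x
      (fun y hy he m hm h => by
        rw [← hper y hy] at hm ⊢
        exact six_mul_lt hM (hin y hy) he hm h)
      (fun y he hs hf => hs (smooth_of_inBase hW he hf))
      (fun y hs => inBase_e_iterate (m := 1) fun k hk => by
        obtain rfl : k = 0 := by omega
        exact hs) rfl rfl with h | h | ⟨hj, hi, hi3, v, hv, m, hm, he, hs, hlt⟩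
  · refine absurd (mem_rels_of_forall_smooth hM hx (fun k => (h _ (sameCycle_iterate x k)).1)
      (h x (Equiv.Perm.SameCycle.refl _ _)).2) hWr
  · omega
  · obtain ⟨s, hs', hsb⟩ := M.exists_iterate_base (he m le_rfl)
    have hback : ∀ t ≤ m, M.f^[s + t] M.base = M.e (M.f^[m - t] v) := by
      intro t ht
      have := iterate_e_iterate (x := M.f^[m - t] v) (m := t) fun k hk => by
        rw [← iterate_add_apply]; exact hs _ (by omega)
      rw [← this, add_comm, iterate_add_apply, hsb, ← iterate_add_apply, Nat.add_sub_cancel' ht]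
    by_cases hle : s + (m + 1) ≤ W.length
    · have hlen : (wordInv (faceWord M.f M.lab (M.f (M.f^[m] v)))).length =
          minimalPeriod M.f x := by
        rw [length_wordInv, length_faceWord, minimalPeriod_f,
          minimalPeriod_apply_iterate (M.f.injective.mem_periodicPts _), hper v hv]
      have h := hshell s (m + 1) _ _ (P.inv_mem _ (hM.mem_rels _ ?_)) hle
        (take_drop_prefix_of_run hsb hs (by rwa [hper v hv]) hle) hi hi3 (by rwa [hlen])
      · have hK := Finset.card_le_card (s := K.filter fun k => s < k ∧ k < s + (m + 1))
          (t := K.filter fun k => M.f.SameCycle x (M.e (M.f^[k] M.base))) fun k hk => by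
            simp only [Finset.mem_filter] at hk ⊢
            refine ⟨hk.1, ?_⟩
            obtain ⟨t, rfl⟩ := Nat.exists_eq_add_of_le hk.2.1.le
            rw [hback t (by omega), M.e_e]
            exact hv.trans (sameCycle_iterate v _)
        omega
      · rw [M.inBase_f, M.inBase_iterate]
        exact hin v hv
    · have : M.f.SameCycle x (M.e M.base) := by
        have h1 := hback (W.length - s) (by omega)
        rw [Nat.add_sub_cancel' hs'.le, ← M.minimalPeriod_base, iterate_minimalPeriod] at h1
        rw [h1, M.e_e]
        exact hv.trans (sameCycle_iterate v _)
      rw [if_pos this]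
      omega

open Classical in
theorem card_add_two_mul_card_le :
    (Finset.univ.filter fun y => ¬ M.InBase y ∧ ¬ M.Smooth y ∧ ¬ M.InBase (M.e y)).card +
      2 * (Finset.univ.filter fun y => ¬ M.InBase y ∧ ¬ M.Smooth y ∧ M.InBase (M.e y)).card ≤
    Fintype.card {x // ¬ M.Smooth x} := by
  have hinj : (Finset.univ.filter fun y => ¬ M.InBase y ∧ ¬ M.Smooth y ∧ M.InBase (M.e y)).card ≤
      (Finset.univ.filter fun y => M.InBase y ∧ ¬ M.Smooth y).card := by
    refine Finset.card_le_card_of_injOn (fun y => M.f.symm (M.e y)) ?_ ?_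
    · intro y hy
      simp only [Finset.coe_filter, Finset.mem_univ, true_and, Set.mem_ofPred_eq] at hy ⊢
      refine ⟨by rw [← M.inBase_f, Equiv.apply_symm_apply]; exact hy.2.2, fun hs => hy.2.1 ?_⟩
      rw [Smooth, Equiv.apply_symm_apply, M.e_e] at hs
      rw [Smooth, hs, M.e_e, Equiv.apply_symm_apply]
    · intro y _ z _ h
      have h := congrArg M.e (M.f.symm.injective h)
      rwa [M.e_e, M.e_e] at h
  have hdisj : (Finset.univ.filter fun y => ¬ M.InBase y ∧ ¬ M.Smooth y ∧ ¬ M.InBase (M.e y)).card +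
      (Finset.univ.filter fun y => ¬ M.InBase y ∧ ¬ M.Smooth y ∧ M.InBase (M.e y)).card +
      (Finset.univ.filter fun y => M.InBase y ∧ ¬ M.Smooth y).card =
      Fintype.card {x // ¬ M.Smooth x} := by
    rw [Fintype.card_subtype, Finset.card_filter, Finset.card_filter, Finset.card_filter,
      Finset.card_filter, ← Finset.sum_add_distrib, ← Finset.sum_add_distrib]
    refine Finset.sum_congr rfl fun y _ => ?_
    by_cases h₁ : M.InBase y <;> by_cases h₂ : M.Smooth y <;> by_cases h₃ : M.InBase (M.e y) <;>
      simp [h₁, h₂, h₃]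
  omega

end Diagram

open Classical in
theorem sum_card_filter_eq {ι D : Type} (K : Finset ι) (s : Finset D) (g : ι → D) :
    ∑ y ∈ s, (K.filter fun k => g k = y).card = (K.filter fun k => g k ∈ s).card := by
  simp only [Finset.card_filter]
  rw [Finset.sum_comm]
  simp only [Finset.sum_ite_eq]

open Classical in
/-- **Greendlinger's lemma.** Let `W` be the label of a simple closed path. If every subword of
`W` making up more than half of a relator contains sufficiently many of at most two marked points
in its interior, then `W` is a relator. -/
theorem greendlinger (hne : W ≠ []) (hred : ∀ x, W ≠ [x, letterInv x]) (h1 : P.elt W = 1)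
    (hW : IsSimple P W) (K : Finset ℕ) (hK : K.card ≤ 2)
    (hshell : ∀ s m i r', r' ∈ P.rels → s + m ≤ W.length → (W.drop s).take m <+: r' → 1 ≤ i →
      i ≤ 3 → (6 - i) * r'.length < 6 * m → 4 - i ≤ (K.filter fun k => s < k ∧ k < s + m).card) :
    W ∈ P.rels := by
  by_contra hWr
  obtain ⟨M, hM⟩ := exists_isReduced (exists_diagram P hne h1)
  have hI := M.card_add_two_mul_card_le
  have hE := M.card_not_smooth_add_le hM hW hred
  have hF := mul_orbitCount_le M.f (fun y =>
    (if ¬ M.InBase y ∧ ¬ M.Smooth y ∧ ¬ M.InBase (M.e y) then 1 else 0) +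
    2 * (if ¬ M.InBase y ∧ ¬ M.Smooth y ∧ M.InBase (M.e y) then 1 else 0) +
    (if M.e M.base = y then 3 else 0) +
    (∑ k ∈ K, if M.e (M.f^[k] M.base) = y then 1 else 0) +
    (if M.base = y then 6 else 0)) 6 fun x => by
      simp only [Finset.sum_add_distrib, ← Finset.mul_sum, ← Finset.card_filter,
        Finset.filter_filter]
      rw [sum_card_filter_eq]
      simp only [Finset.sum_ite_eq, Finset.mem_filter, Finset.mem_univ, true_and]
      by_cases hx : M.InBase x
      · have : M.f.SameCycle x M.base := by
          obtain ⟨k, rfl⟩ := hx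
          exact (sameCycle_iterate _ k).symm
        rw [if_pos this]
        omega
      · have hin : ∀ y, M.f.SameCycle x y → ¬ M.InBase y := fun y hy => by
          rwa [← M.inBase_iff_of_sameCycle hy]
        have := Diagram.curvature_le hM hW K hWr hshell hx
        have hdrop : ∀ (Q : M.D → Prop) [DecidablePred Q],
            (Finset.univ.filter fun y => M.f.SameCycle x y ∧ Q y).card =
            (Finset.univ.filter fun y => M.f.SameCycle x y ∧ ¬ M.InBase y ∧ Q y).card := fun Q _ =>
          congrArg _ (Finset.filter_congr fun y _ =>
            ⟨fun h => ⟨h.1, hin y h.1, h.2⟩, fun h => ⟨h.1, h.2.2⟩⟩)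
        have e₁ := hdrop fun y => ¬ M.Smooth y ∧ ¬ M.InBase (M.e y)
        have e₂ := hdrop fun y => ¬ M.Smooth y ∧ M.InBase (M.e y)
        omega
  simp only [Finset.sum_add_distrib, ← Finset.mul_sum, ← Finset.card_filter] at hF
  rw [sum_card_filter_eq] at hF
  simp only [Finset.sum_ite_eq, Finset.mem_univ, if_true, Finset.filter_true] at hF
  omega

end GSC


namespace GSC

open Function

variable {S : Type}

/-! ### Geodesic words -/

section WordLength

variable {G : Type*} [Group G] (X : Set G)

theorem wordLength_prod_le {l : List G} (hl : ∀ x ∈ l, x ∈ X ∨ x⁻¹ ∈ X) :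
    wordLength X l.prod ≤ l.length :=
  Nat.sInf_le ⟨l, rfl, hl, rfl⟩

end WordLength

variable (P : C6Presentation S)

theorem letter_mem (a : S × Bool) : P.letter a ∈ P.gens ∨ (P.letter a)⁻¹ ∈ P.gens := by
  rcases a with ⟨a, _ | _⟩
  · exact Or.inr ⟨a, by simp [C6Presentation.letter]⟩
  · exact Or.inl ⟨a, by simp [C6Presentation.letter]⟩

theorem elt_eq_prod (U : Word S) : P.elt U = (U.map P.letter).prod := by
  induction U with
  | nil => rfl
  | cons a U ih => simp [ih]

theorem wordLength_elt_le (U : Word S) : wordLength P.gens (P.elt U) ≤ U.length := by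
  rw [elt_eq_prod]
  refine (wordLength_prod_le _ fun x hx => ?_).trans_eq (List.length_map _)
  obtain ⟨a, -, rfl⟩ := List.mem_map.1 hx
  exact letter_mem P a

theorem exists_elt_eq_prod (l : List P.Grp) (hl : ∀ x ∈ l, x ∈ P.gens ∨ x⁻¹ ∈ P.gens) :
    ∃ U : Word S, P.elt U = l.prod ∧ U.length = l.length := by
  induction l with
  | nil => exact ⟨[], rfl, rfl⟩
  | cons x l ih =>
    obtain ⟨U, hU, hlen⟩ := ih fun y hy => hl y (List.mem_cons_of_mem _ hy)
    obtain ⟨a, ha⟩ : ∃ a, P.letter a = x := by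
      rcases hl x List.mem_cons_self with ⟨a, ha⟩ | ⟨a, ha⟩
      · exact ⟨(a, true), by simpa [C6Presentation.letter] using ha⟩
      · exact ⟨(a, false), by simpa [C6Presentation.letter, inv_eq_iff_eq_inv] using ha⟩
    exact ⟨a :: U, by simp [ha, hU], by simp [hlen]⟩

/-- A word is geodesic if it is a shortest word for the element it represents. -/
def IsGeodWord (U : Word S) : Prop := wordLength P.gens (P.elt U) = U.length

theorem exists_geodWord (g : P.Grp) : ∃ U : Word S, P.elt U = g ∧ IsGeodWord P U := by
  have hne : {n : ℕ | ∃ l : List P.Grp, l.length = n ∧ (∀ x ∈ l, x ∈ P.gens ∨ x⁻¹ ∈ P.gens) ∧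
      l.prod = g}.Nonempty := by
    obtain ⟨x, rfl⟩ := PresentedGroup.mk_surjective _ g
    obtain ⟨L, rfl⟩ := Quot.exists_rep x
    refine ⟨_, L.map P.letter, rfl, fun y hy => ?_, ?_⟩
    · obtain ⟨a, -, rfl⟩ := List.mem_map.1 hy
      exact letter_mem P a
    · rw [← elt_eq_prod, elt_eq_mk, wordVal_eq_mk]
      rfl
  obtain ⟨l, hl, hlX, rfl⟩ := Nat.sInf_mem hne
  obtain ⟨U, hU, hlen⟩ := exists_elt_eq_prod P l hlX
  exact ⟨U, hU, by rw [IsGeodWord, hU, hlen, hl]; rfl⟩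

theorem wordLength_mul_le (g h : P.Grp) :
    wordLength P.gens (g * h) ≤ wordLength P.gens g + wordLength P.gens h := by
  obtain ⟨U, rfl, hU⟩ := exists_geodWord P g
  obtain ⟨V, rfl, hV⟩ := exists_geodWord P h
  rw [hU, hV, ← elt_append, ← List.length_append]
  exact wordLength_elt_le P _

theorem wordLength_inv (g : P.Grp) : wordLength P.gens g⁻¹ = wordLength P.gens g := by
  have h : ∀ g, wordLength P.gens g⁻¹ ≤ wordLength P.gens g := fun g => by
    obtain ⟨U, rfl, hU⟩ := exists_geodWord P g
    rw [hU, ← elt_wordInv, ← length_wordInv U]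
    exact wordLength_elt_le P _
  exact (h g).antisymm (by simpa using h g⁻¹)

variable {P}

theorem IsGeodWord.wordInv {U : Word S} (h : IsGeodWord P U) : IsGeodWord P (wordInv U) := by
  rw [IsGeodWord, elt_wordInv, wordLength_inv, h, length_wordInv]

theorem IsGeodWord.of_append {U V : Word S} (h : IsGeodWord P (U ++ V)) :
    IsGeodWord P U ∧ IsGeodWord P V := by
  have h₁ := wordLength_elt_le P U
  have h₂ := wordLength_elt_le P V
  have h₃ := wordLength_mul_le P (P.elt U) (P.elt V)
  rw [← elt_append, h, List.length_append] at h₃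
  exact ⟨by unfold IsGeodWord; omega, by unfold IsGeodWord; omega⟩

theorem IsGeodWord.take {U : Word S} (h : IsGeodWord P U) (k : ℕ) : IsGeodWord P (U.take k) := by
  rw [← List.take_append_drop k U] at h
  exact h.of_append.1

theorem IsGeodWord.drop {U : Word S} (h : IsGeodWord P U) (k : ℕ) : IsGeodWord P (U.drop k) := by
  rw [← List.take_append_drop k U] at h
  exact h.of_append.2

theorem elt_take_drop (U : Word S) (p q : ℕ) (h : p ≤ q) :
    P.elt ((U.drop p).take (q - p)) = (P.elt (U.take p))⁻¹ * P.elt (U.take q) := by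
  rw [eq_inv_mul_iff_mul_eq, ← elt_append, List.take_drop, Nat.add_sub_cancel' h]
  congr 1
  conv_rhs => rw [← List.take_append_drop p (U.take q), List.take_take, min_eq_left h]

theorem IsGeodWord.elt_take_ne {U : Word S} (h : IsGeodWord P U) {p q : ℕ} (hpq : p < q)
    (hq : q ≤ U.length) : P.elt (U.take p) ≠ P.elt (U.take q) := by
  intro heq
  have h1 := (h.drop p).take (q - p)
  rw [IsGeodWord, elt_take_drop U p q hpq.le, heq, inv_mul_cancel, ← elt_nil P] at h1
  have h2 := wordLength_elt_le P []
  simp only [List.length_take, List.length_drop, List.length_nil] at h1 h2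
  omega

/-- A geodesic prefix of a relator is at most half of it. -/
theorem IsGeodWord.two_mul_length_le {U r : Word S} (h : IsGeodWord P U) (hr : r ∈ P.rels)
    (hU : U <+: r) : 2 * U.length ≤ r.length := by
  obtain ⟨V, rfl⟩ := hU
  have h1 := elt_of_mem_rels P hr
  rw [elt_append, mul_eq_one_iff_eq_inv] at h1
  have h2 := wordLength_elt_le P V
  rw [← wordLength_inv, ← h1, h] at h2
  rw [List.length_append]
  omega

theorem take_drop_prefix_rotate {W r : Word S} {s m p q : ℕ} (h : (W.drop s).take m <+: r)
    (hsm : s + m ≤ W.length) (hp : s ≤ p) (hpq : p ≤ q) (hq : q ≤ s + m) :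
    (W.drop p).take (q - p) <+: r.rotate (p - s) := by
  obtain ⟨V, rfl⟩ := h
  have hl : ((W.drop s).take m).length = m := by simp; omega
  rw [List.rotate_eq_drop_append_take (by rw [List.length_append]; omega),
    List.drop_append_of_le_length (by omega), List.append_assoc]
  refine List.IsPrefix.trans ?_ (List.prefix_append _ _)
  rw [List.drop_take, List.drop_drop, Nat.add_sub_cancel' hp]
  exact List.take_prefix_take_left (by omega)

theorem infix_prefix_rotate {W r : Word S} {p q : ℕ} (h : W <+: r)
    (hpq : p ≤ q) (hq : q ≤ W.length) : (W.drop p).take (q - p) <+: r.rotate p :=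
  take_drop_prefix_rotate (s := 0) (m := W.length) (by simpa using h) (by omega) (by omega) hpq
    (by omega)

theorem six_mul_length_lt_of_ne {U r₁ r₂ : Word S} (h₁ : r₁ ∈ P.rels) (h₂ : r₂ ∈ P.rels)
    (hne : r₁ ≠ r₂) (hU₁ : U <+: r₁) (hU₂ : U <+: r₂) : 6 * U.length < r₁.length :=
  P.small_cancellation r₁ h₁ U hU₁ ⟨r₁, h₁, r₂, h₂, hne, hU₁, hU₂⟩

/-- Relators embed. -/
theorem elt_ne_one_of_prefix {U r : Word S} (hr : r ∈ P.rels) (hU : U <+: r) (h0 : U ≠ [])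
    (h2 : 2 * U.length ≤ r.length) : P.elt U ≠ 1 := by
  induction hn : U.length using Nat.strong_induction_on generalizing U r with
  | _ n ih =>
  subst hn
  intro h1
  have hpos : 0 < U.length := List.length_pos_iff.2 h0
  have hUr : U ∈ P.rels := by
    classical
    refine greendlinger h0 ?_ h1 ?_ ∅ (by simp) ?_
    · rintro x rfl
      obtain ⟨V, rfl⟩ := hU
      have := P.cyclically_reduced _ hr
      rw [CyclicallyReduced, Reduced] at this
      simp only [List.cons_append] at this
      exact ne_letterInv_iff.2 (List.isChain_cons_cons.1 this).1 rfl
    · intro i j hij hj heq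
      refine ih (j - i) (by omega) (U := (U.drop i).take (j - i)) (P.rotate_mem r hr i)
        (infix_prefix_rotate hU hij.le hj.le) ?_ ?_ (by simp; omega) ?_
      · rw [← List.length_pos_iff]; simp; omega
      · simp; omega
      · rw [elt_take_drop U i j hij.le, heq, inv_mul_cancel]
    · intro s m i r' hr' hsm hpre hi hi3 hlt
      exfalso
      have hl : ((U.drop s).take m).length = m := by simp; omega
      have h3 : 3 * r'.length ≤ (6 - i) * r'.length := Nat.mul_le_mul_right _ (by omega)
      have hpre' : (U.drop s).take m <+: r.rotate s := by
        simpa using infix_prefix_rotate (p := s) (q := s + m) hU (by omega) hsm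
      by_cases heq : r' = r.rotate s
      · have : r'.length = r.length := by rw [heq, List.length_rotate]
        omega
      · have := six_mul_length_lt_of_ne hr' (P.rotate_mem r hr s) heq hpre hpre'
        omega
  have := six_mul_length_lt_of_ne hUr hr (fun h => by subst h; omega) (List.prefix_refl U) hU
  omega

/-! ### Relator cycles -/

theorem mul_elt_take_mem_relatorCycle (g : P.Grp) (r : Word S) (k : ℕ) :
    g * P.elt (r.take k) ∈ relatorCycle P g r :=
  ⟨_, List.take_prefix _ _, rfl⟩

theorem relatorCycle_rotate_subset (g : P.Grp) {r : Word S} (hr : r ∈ P.rels) {k : ℕ}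
    (hk : k ≤ r.length) :
    relatorCycle P (g * P.elt (r.take k)) (r.rotate k) ⊆ relatorCycle P g r := by
  rintro _ ⟨p, hp, rfl⟩
  rw [List.prefix_iff_eq_take, List.rotate_eq_drop_append_take hk, List.take_append] at hp
  rw [hp, elt_append, ← mul_assoc, mul_assoc g, ← elt_append]
  rcases le_total p.length (r.length - k) with hle | hle
  · rw [List.length_drop, Nat.sub_eq_zero_of_le hle, List.take_zero, elt_nil, mul_one,
      ← List.take_add]
    exact mul_elt_take_mem_relatorCycle g r _
  · rw [List.take_of_length_le (l := r.drop k) (by rw [List.length_drop]; exact hle),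
      List.take_append_drop,
      elt_of_mem_rels P hr, mul_one, List.take_take]
    exact mul_elt_take_mem_relatorCycle g r _

theorem subset_relatorCycle_rotate (g : P.Grp) {r : Word S} (hr : r ∈ P.rels) {k : ℕ}
    (hk : k ≤ r.length) :
    relatorCycle P g r ⊆ relatorCycle P (g * P.elt (r.take k)) (r.rotate k) := by
  have h := relatorCycle_rotate_subset (g * P.elt (r.take k)) (P.rotate_mem r hr k)
    (k := r.length - k) (by rw [List.length_rotate]; omega)
  have hd : (r.rotate k).take (r.length - k) = r.drop k := by
    rw [List.rotate_eq_drop_append_take hk, List.take_left' (by simp)]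
  rwa [hd, mul_assoc, ← elt_append, List.take_append_drop, elt_of_mem_rels P hr, mul_one,
    List.rotate_rotate, Nat.add_sub_cancel' hk, List.rotate_length] at h

theorem relatorCycle_wordInv_subset (g : P.Grp) {r : Word S} (hr : r ∈ P.rels) :
    relatorCycle P g (wordInv r) ⊆ relatorCycle P g r := by
  rintro _ ⟨p, ⟨q, hq⟩, rfl⟩
  have hq := congrArg wordInv hq
  rw [wordInv_wordInv, wordInv_append] at hq
  refine ⟨wordInv q, ⟨wordInv p, hq⟩, ?_⟩
  have h := elt_of_mem_rels P hr
  rw [← hq, elt_append, elt_wordInv P p, mul_inv_eq_one] at h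
  rw [h]

/-- Any two points of a relator cycle are joined by an arc of at most half its length. -/
theorem exists_arc {g : P.Grp} {r : Word S} (hr : r ∈ P.rels) {z w : P.Grp}
    (hz : z ∈ relatorCycle P g r) (hw : w ∈ relatorCycle P g r) :
    ∃ r₁ ∈ P.rels, ∃ C, C <+: r₁ ∧ 2 * C.length ≤ r₁.length ∧ w = z * P.elt C ∧
      relatorCycle P z r₁ ⊆ relatorCycle P g r := by
  obtain ⟨p, hp, rfl⟩ := hz
  rw [List.prefix_iff_eq_take] at hp
  by_cases hk : p.length ≤ r.length
  · rw [hp]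
    have hsub := relatorCycle_rotate_subset g hr hk
    have hr₁ := P.rotate_mem r hr p.length
    obtain ⟨C, ⟨D, hC⟩, rfl⟩ := subset_relatorCycle_rotate g hr hk hw
    by_cases h2 : 2 * C.length ≤ (r.rotate p.length).length
    · exact ⟨_, hr₁, C, ⟨D, hC⟩, h2, rfl, hsub⟩
    · refine ⟨_, P.inv_mem _ hr₁, wordInv D, ?_, ?_, ?_,
        (relatorCycle_wordInv_subset _ hr₁).trans hsub⟩
      · rw [← hC, wordInv_append]
        exact List.prefix_append _ _
      · rw [length_wordInv, length_wordInv]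
        rw [← hC, List.length_append] at h2 ⊢
        omega
      · have h := elt_of_mem_rels P hr₁
        rw [← hC, elt_append, mul_eq_one_iff_eq_inv] at h
        rw [elt_wordInv, h]
  · have := congrArg List.length hp
    simp at this
    omega

end GSC


namespace GSC

open Function

variable {S : Type} {P : C6Presentation S}

/-! ### Geodesics leaving a relator cycle -/

open Classical in
theorem length_lt_of_disjoint {r A B C : Word S} (hr : r ∈ P.rels) (hC : C <+: r)
    (hC2 : 2 * C.length ≤ r.length) (hC0 : C ≠ []) (hA : IsGeodWord P A) (hB : IsGeodWord P B)
    (hA0 : A ≠ []) (hB0 : B ≠ [])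
    (hAr : ∀ k, 1 ≤ k → k ≤ A.length → ∀ p, p <+: r → P.elt (A.take k) ≠ P.elt p)
    (hBr : ∀ k, 1 ≤ k → k ≤ B.length → ∀ p, p <+: r → P.elt C * P.elt (B.take k) ≠ P.elt p)
    (hy : P.elt A = P.elt C * P.elt B)
    (hdisj : ∀ i j, 1 ≤ i → i ≤ A.length → 1 ≤ j → j ≤ B.length →
      P.elt (A.take i) = P.elt C * P.elt (B.take j) → i = A.length ∧ j = B.length) :
    C.length < B.length := by
  by_contra! hBC
  have ha : 0 < A.length := List.length_pos_iff.2 hA0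
  have hb : 0 < B.length := List.length_pos_iff.2 hB0
  have hc : 0 < C.length := List.length_pos_iff.2 hC0
  obtain ⟨W, hW⟩ : ∃ W, W = wordInv A ++ (C ++ B) := ⟨_, rfl⟩
  have hlW : W.length = A.length + (C.length + B.length) := by simp [hW]
  -- the vertices of the path `W`
  have vA : ∀ i ≤ A.length, P.elt A * P.elt (W.take i) = P.elt (A.take (A.length - i)) := by
    intro i hi
    rw [hW, List.take_append_of_le_length (by simpa using hi)]
    conv_lhs => rw [← List.take_append_drop (A.length - i) A]
    rw [wordInv_append, List.take_left' (by simp; omega), elt_append, elt_wordInv,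
      mul_inv_cancel_right]
  have vC : ∀ i, A.length ≤ i → i ≤ A.length + C.length →
      P.elt A * P.elt (W.take i) = P.elt (C.take (i - A.length)) := by
    intro i hi hi2
    rw [hW, List.take_append, List.take_of_length_le (by simpa using hi), length_wordInv,
      List.take_append_of_le_length (by omega), elt_append, elt_wordInv, mul_inv_cancel_left]
  have vB : ∀ i, A.length + C.length ≤ i →
      P.elt A * P.elt (W.take i) = P.elt C * P.elt (B.take (i - A.length - C.length)) := by
    intro i hi
    rw [hW, List.take_append, List.take_of_length_le (by simp; omega), length_wordInv,
      List.take_append, List.take_of_length_le (l := C) (by omega), elt_append, elt_append,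
      elt_wordInv, mul_inv_cancel_left]
  -- subwords of `W`
  have sA : ∀ p q, p ≤ q → q ≤ A.length → IsGeodWord P ((W.drop p).take (q - p)) := by
    intro p q hpq hq
    rw [hW, List.drop_append_of_le_length (by simp; omega),
      List.take_append_of_le_length (by simp; omega)]
    exact (hA.wordInv.drop p).take _
  have sB : ∀ p q, A.length + C.length ≤ p → IsGeodWord P ((W.drop p).take (q - p)) := by
    intro p q hp
    rw [hW, ← List.append_assoc, List.drop_append, List.drop_of_length_le (by simp; omega),
      List.nil_append]
    exact (hB.drop _).take _
  have sC : ∀ p q, A.length ≤ p → p ≤ q → q ≤ A.length + C.length →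
      (W.drop p).take (q - p) <+: r.rotate (p - A.length) := by
    intro p q hp hpq hq
    rw [hW, List.drop_append, List.drop_of_length_le (by simp; omega), List.nil_append,
      length_wordInv, List.drop_append_of_le_length (by omega),
      List.take_append_of_le_length (by simp; omega),
      show q - p = (q - A.length) - (p - A.length) by omega]
    exact infix_prefix_rotate hC (by omega) (by omega)
  have wA : (W.drop (A.length - 1)).take (A.length - (A.length - 1)) = [letterInv A[0]] := by
    rw [show A.length - (A.length - 1) = 1 by omega, List.take_one_drop_eq_of_lt_length (by omega)]
    subst hW
    rw [List.get_eq_getElem, List.getElem_append_left (by simp; omega)]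
    simp [wordInv_eq]
  have wB : (W.drop (A.length + C.length)).take (A.length + C.length + 1 - (A.length + C.length)) =
      [B[0]] := by
    rw [Nat.add_sub_cancel_left, List.take_one_drop_eq_of_lt_length (by omega)]
    subst hW
    rw [List.get_eq_getElem, List.getElem_append_right (by simp)]
    simp
  -- the arc `C` is not aligned with a relator extending it in `W`
  have hpiece : ∀ s m r', r' ∈ P.rels → s + m ≤ W.length → (W.drop s).take m <+: r' →
      ∀ p q, s ≤ p → p ≤ q → q ≤ s + m → A.length ≤ p → q ≤ A.length + C.length →
      (s < A.length ∧ p = A.length) ∨ (A.length + C.length < s + m ∧ q = A.length + C.length) →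
      6 * (q - p) < r'.length := by
    intro s m r' hr' hsm hpre p q hsp hpq hq hap hqc hor
    have h₁ := take_drop_prefix_rotate hpre hsm hsp hpq hq
    have h₂ := sC p q hap hpq hqc
    have hl : ((W.drop p).take (q - p)).length = q - p := by simp; omega
    have hne : r'.rotate (p - s) ≠ r.rotate (p - A.length) := by
      intro heq
      rcases hor with ⟨hs, rfl⟩ | ⟨hs, rfl⟩
      · rw [Nat.sub_self, List.rotate_zero] at heq
        have h := take_drop_prefix_rotate (p := A.length - 1) (q := A.length) hpre hsm (by omega)
          (by omega) (by omega)
        rw [wA] at h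
        obtain ⟨V, hV⟩ := h
        have hrV : r = V ++ [letterInv A[0]] := by
          rw [← heq, show A.length - s = A.length - 1 - s + 1 by omega, ← List.rotate_rotate, ← hV]
          simp
        have h1 := elt_of_mem_rels P hr
        rw [hrV, elt_append, elt_cons, elt_nil, letter_letterInv, mul_one, mul_inv_eq_one] at h1
        refine hAr 1 le_rfl ha V ⟨_, hrV.symm⟩ ?_
        rw [h1]
        simpa using elt_take_succ P A 0 ha
      · have h := take_drop_prefix_rotate (p := A.length + C.length) (q := A.length + C.length + 1)
          hpre hsm (by omega) (by omega) (by omega)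
        rw [wB, show A.length + C.length - s = p - s + (A.length + C.length - p) by omega,
          ← List.rotate_rotate, heq, List.rotate_rotate,
          show p - A.length + (A.length + C.length - p) = C.length by omega] at h
        obtain ⟨D, hD⟩ := hC
        rw [← hD, List.rotate_append_length_eq] at h
        have hDl : 0 < D.length := by
          rw [← hD, List.length_append] at hC2
          omega
        obtain ⟨x, D', rfl⟩ := List.exists_cons_of_length_pos hDl
        simp only [List.cons_append, List.cons_prefix_cons, List.nil_prefix, and_true] at h
        refine hBr 1 le_rfl hb (C ++ [x]) ⟨D', by simpa using hD⟩ ?_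
        have := elt_take_succ P B 0 hb
        simp only [zero_add, List.take_zero, elt_nil, one_mul] at this
        simp [this, elt_append, h]
    have := six_mul_length_lt_of_ne (P.rotate_mem _ hr' _) (P.rotate_mem _ hr _) hne h₁ h₂
    rwa [hl, List.length_rotate] at this
  have hgeod : ∀ s m r', r' ∈ P.rels → s + m ≤ W.length → (W.drop s).take m <+: r' →
      ∀ p q, s ≤ p → p ≤ q → q ≤ s + m → q ≤ A.length ∨ A.length + C.length ≤ p →
      2 * (q - p) ≤ r'.length := by
    intro s m r' hr' hsm hpre p q hsp hpq hq hor
    have hl : ((W.drop p).take (q - p)).length = q - p := by simp; omega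
    have h₁ := take_drop_prefix_rotate hpre hsm hsp hpq hq
    have hg : IsGeodWord P ((W.drop p).take (q - p)) := by
      rcases hor with h | h
      exacts [sA p q hpq h, sB p q h]
    have := hg.two_mul_length_le (P.rotate_mem _ hr' _) h₁
    rwa [hl, List.length_rotate] at this
  have hsimple : IsSimple P W := by
    intro i j hij hj heq
    have heq : P.elt A * P.elt (W.take i) = P.elt A * P.elt (W.take j) := by rw [heq]
    have hBr' : ∀ k, 1 ≤ k → k ≤ B.length → ∀ l, P.elt C * P.elt (B.take k) ≠ P.elt (C.take l) :=
      fun k h1 h2 l => hBr k h1 h2 _ ((List.take_prefix _ _).trans hC)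
    rcases lt_or_ge i A.length with hiA | hiA
    · rw [vA i hiA.le] at heq
      rcases lt_or_ge j A.length with hjA | hjA
      · rw [vA j hjA.le] at heq
        exact hA.elt_take_ne (p := A.length - j) (q := A.length - i) (by omega) (by omega) heq.symm
      · rcases le_or_gt j (A.length + C.length) with hjC | hjC
        · rw [vC j hjA hjC] at heq
          exact hAr _ (by omega) (by omega) _ ((List.take_prefix _ _).trans hC) heq
        · rw [vB j hjC.le] at heq
          have := hdisj _ _ (by omega) (by omega) (by omega) (by omega) heq
          omega
    · rcases le_or_gt i (A.length + C.length) with hiC | hiC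
      · rw [vC i hiA hiC] at heq
        rcases le_or_gt j (A.length + C.length) with hjC | hjC
        · rw [vC j (by omega) hjC] at heq
          refine elt_ne_one_of_prefix (P.rotate_mem r hr _)
            (sC i j hiA hij.le hjC) ?_ ?_ ?_
          · rw [← List.length_pos_iff]; simp; omega
          · simp; omega
          · rw [elt_take_drop W i j hij.le, inv_mul_eq_one]
            refine mul_left_cancel (a := P.elt A) ?_
            rw [vC i hiA hiC, vC j (by omega) hjC, heq]
        · rw [vB j hjC.le] at heq
          exact hBr' _ (by omega) (by omega) _ heq.symm
      · rw [vB i hiC.le, vB j (by omega)] at heq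
        exact hB.elt_take_ne (by omega) (by omega) (mul_left_cancel heq)
  have hW1 : P.elt W = 1 := by
    rw [hW, elt_append, elt_append, elt_wordInv, ← hy, inv_mul_cancel]
  have hWr : W ∈ P.rels := by
    refine greendlinger (by rw [← List.length_pos_iff]; omega) ?_ hW1 hsimple
      {A.length, A.length + C.length} Finset.card_le_two ?_
    · intro x hx
      have := congrArg List.length hx
      simp at this
      omega
    · intro s m i r' hr' hsm hpre hi hi3 hlt
      have hcard : (if s < A.length ∧ A.length < s + m then 1 else 0) +
          (if s < A.length + C.length ∧ A.length + C.length < s + m then 1 else 0) ≤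
          (({A.length, A.length + C.length} : Finset ℕ).filter
            fun k => s < k ∧ k < s + m).card := by
        rw [Finset.card_filter, Finset.sum_pair (by omega)]
      refine le_trans ?_ hcard
      have hP := hpiece s m r' hr' hsm hpre
      have hG := hgeod s m r' hr' hsm hpre
      clear hcard hpiece hgeod
      have h3 : 6 - i = 3 ∧ i = 3 ∨ 6 - i = 4 ∧ i = 2 ∨ 6 - i = 5 ∧ i = 1 := by omega
      rcases le_or_gt (s + m) A.length with h1 | h1
      · have := hG s (s + m) le_rfl (by omega) le_rfl (Or.inl h1)
        rcases h3 with ⟨h, -⟩ | ⟨h, -⟩ | ⟨h, -⟩ <;> rw [h] at hlt <;> omega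
      rcases le_or_gt (A.length + C.length) s with h2 | h2
      · have := hG s (s + m) le_rfl (by omega) le_rfl (Or.inr h2)
        rcases h3 with ⟨h, -⟩ | ⟨h, -⟩ | ⟨h, -⟩ <;> rw [h] at hlt <;> omega
      rcases lt_or_ge s A.length with hs | hs
      · have g1 := hG s A.length le_rfl hs.le h1.le (Or.inl le_rfl)
        rcases lt_or_ge (A.length + C.length) (s + m) with hm | hm
        · have g2 := hP A.length (A.length + C.length) hs.le (by omega) hm.le le_rfl le_rfl
            (Or.inl ⟨hs, rfl⟩)
          rw [if_pos ⟨hs, h1⟩, if_pos ⟨h2, hm⟩]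
          rcases h3 with ⟨h, h'⟩ | ⟨h, h'⟩ | ⟨h, h'⟩ <;> rw [h] at hlt <;> omega
        · have g2 := hP A.length (s + m) hs.le (by omega) le_rfl le_rfl hm (Or.inl ⟨hs, rfl⟩)
          rw [if_pos ⟨hs, h1⟩]
          rcases h3 with ⟨h, h'⟩ | ⟨h, h'⟩ | ⟨h, h'⟩ <;> rw [h] at hlt <;> omega
      · rcases lt_or_ge (A.length + C.length) (s + m) with hm | hm
        · have g1 := hG (A.length + C.length) (s + m) h2.le hm.le le_rfl (Or.inr le_rfl)
          have g2 := hP s (A.length + C.length) le_rfl h2.le hm.le hs le_rfl (Or.inr ⟨hm, rfl⟩)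
          rw [if_pos (c := s < A.length + C.length ∧ _) ⟨h2, hm⟩]
          rcases h3 with ⟨h, h'⟩ | ⟨h, h'⟩ | ⟨h, h'⟩ <;> rw [h] at hlt <;> omega
        · have g1 := sC s (s + m) hs (by omega) hm
          rw [Nat.add_sub_cancel_left] at g1
          have hlen : r'.length = r.length ∨ 6 * m < r'.length := by
            by_cases heq : r' = r.rotate (s - A.length)
            · exact Or.inl (by rw [heq, List.length_rotate])
            · have := six_mul_length_lt_of_ne hr' (P.rotate_mem r hr _) heq hpre g1
              rw [List.length_take, List.length_drop] at this
              exact Or.inr (by omega)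
          rcases h3 with ⟨h, -⟩ | ⟨h, -⟩ | ⟨h, -⟩ <;> rw [h] at hlt <;> omega
  have h6 := hpiece 0 W.length W hWr (by omega) (by simp) A.length (A.length + C.length)
    (by omega) (by omega) (by omega) le_rfl le_rfl (Or.inl ⟨ha, rfl⟩)
  have h2 := hgeod 0 W.length W hWr (by omega) (by simp) 0 A.length le_rfl (by omega) (by omega)
    (Or.inl le_rfl)
  omega

/-- If geodesics from two points of a relator cycle to a common endpoint leave the cycle at once,
then the two points are closer to each other than to the endpoint. -/
theorem wordLength_lt_of_avoid {g : P.Grp} {r : Word S} (hr : r ∈ P.rels) {z w : P.Grp}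
    (hz : z ∈ relatorCycle P g r) (hw : w ∈ relatorCycle P g r) {A B : Word S}
    (hA : IsGeodWord P A) (hB : IsGeodWord P B) (hA0 : A ≠ []) (hB0 : B ≠ [])
    (hAr : ∀ k, 1 ≤ k → k ≤ A.length → z * P.elt (A.take k) ∉ relatorCycle P g r)
    (hBr : ∀ k, 1 ≤ k → k ≤ B.length → w * P.elt (B.take k) ∉ relatorCycle P g r)
    (hy : z * P.elt A = w * P.elt B) : wordLength P.gens (z⁻¹ * w) < B.length := by
  induction hn : A.length + B.length using Nat.strong_induction_on generalizing A B with
  | _ n ih =>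
  subst hn
  have ha : 0 < A.length := List.length_pos_iff.2 hA0
  have hb : 0 < B.length := List.length_pos_iff.2 hB0
  by_cases hdisj : ∀ i j, 1 ≤ i → i ≤ A.length → 1 ≤ j → j ≤ B.length →
      z * P.elt (A.take i) = w * P.elt (B.take j) → i = A.length ∧ j = B.length
  · obtain ⟨r₁, hr₁, C, hC, hC2, rfl, hsub⟩ := exists_arc hr hz hw
    rw [inv_mul_cancel_left]
    refine (wordLength_elt_le P C).trans_lt ?_
    by_cases hC0 : C = []
    · simpa [hC0] using hb
    refine length_lt_of_disjoint hr₁ hC hC2 hC0 hA hB hA0 hB0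
      (fun k h1 h2 p hp heq => hAr k h1 h2 (hsub ⟨p, hp, by rw [heq]⟩))
      (fun k h1 h2 p hp heq => hBr k h1 h2 (hsub ⟨p, hp, by rw [mul_assoc, heq]⟩))
      (mul_left_cancel (a := z) (by rw [hy, mul_assoc]))
      (fun i j h1 h2 h3 h4 heq => hdisj i j h1 h2 h3 h4 (by rw [heq, mul_assoc]))
  · push Not at hdisj
    obtain ⟨i, j, hi1, hi, hj1, hj, heq, hne⟩ := hdisj
    have hlt := ih _ (by
        rw [List.length_take, List.length_take, min_eq_left hi, min_eq_left hj]
        rcases hi.lt_or_eq with h | h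
        · omega
        · have := hne h
          omega) (hA.take i) (hB.take j)
      (by rw [← List.length_pos_iff, List.length_take]; omega)
      (by rw [← List.length_pos_iff, List.length_take]; omega)
      (fun k h1 h2 => by
        rw [List.length_take] at h2
        rw [List.take_take, min_eq_left (by omega)]
        exact hAr k h1 (by omega))
      (fun k h1 h2 => by
        rw [List.length_take] at h2
        rw [List.take_take, min_eq_left (by omega)]
        exact hBr k h1 (by omega)) heq rfl
    rw [List.length_take] at hlt
    omega

end GSC


namespace GSC

open Function

variable {S : Type} {P : C6Presentation S}

/-! ### Closest points -/

theorem exists_word_along (f : ℕ → P.Grp) (n : ℕ)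
    (h : ∀ j < n, wordLength P.gens ((f j)⁻¹ * f (j + 1)) = 1) :
    ∃ A : Word S, A.length = n ∧ ∀ j ≤ n, f 0 * P.elt (A.take j) = f j := by
  induction n with
  | zero => exact ⟨[], rfl, fun j hj => by simp [Nat.le_zero.1 hj]⟩
  | succ n ih =>
    obtain ⟨A, hA, hAf⟩ := ih fun j hj => h j (by omega)
    obtain ⟨V, hV, hVg⟩ := exists_geodWord P ((f n)⁻¹ * f (n + 1))
    rw [IsGeodWord, hV, h n (by omega)] at hVg
    refine ⟨A ++ V, by rw [List.length_append, hA, ← hVg], fun j hj => ?_⟩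
    rcases Nat.lt_or_ge n j with hnj | hjn
    · obtain rfl : j = n + 1 := by omega
      have := hAf n le_rfl
      rw [List.take_of_length_le hA.le] at this
      rw [List.take_of_length_le (by rw [List.length_append]; omega), elt_append, ← mul_assoc, this,
        hV, mul_inv_cancel_left]
    · rw [List.take_append_of_le_length (by omega), hAf j hjn]

/-- A geodesic starting in a relator cycle and ending outside of it contains a point of the cycle
which is closer to a given point of the cycle than the endpoint. -/
theorem exists_closer_of_nat {g : P.Grp} {r : Word S} (hr : r ∈ P.rels) {x : P.Grp}
    (hx : x ∈ relatorCycle P g r) (f : ℕ → P.Grp) (n : ℕ)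
    (hf : ∀ i j, i ≤ j → j ≤ n → wordLength P.gens ((f i)⁻¹ * f j) = j - i)
    (h0 : f 0 ∈ relatorCycle P g r) (hn : f n ∉ relatorCycle P g r) :
    ∃ i ≤ n, f i ∈ relatorCycle P g r ∧
      wordLength P.gens (x⁻¹ * f i) < wordLength P.gens (x⁻¹ * f n) := by
  classical
  obtain ⟨i, hi, hin, hmax⟩ : ∃ i, f i ∈ relatorCycle P g r ∧ i ≤ n ∧
      ∀ k, i < k → k ≤ n → f k ∉ relatorCycle P g r :=
    ⟨Nat.findGreatest (fun i => f i ∈ relatorCycle P g r) n,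
      Nat.findGreatest_spec (P := fun i => f i ∈ relatorCycle P g r) (Nat.zero_le n) h0,
      Nat.findGreatest_le n, fun k h1 h2 => Nat.findGreatest_is_greatest h1 h2⟩
  refine ⟨i, hin, hi, ?_⟩
  have hlt : i < n := hin.lt_of_ne fun h => hn (h ▸ hi)
  obtain ⟨A, hAl, hAf⟩ := exists_word_along (fun j => f (i + j)) (n - i) fun j hj => by
    rw [hf _ _ (by omega) (by omega)]; omega
  simp only [add_zero] at hAf
  have hAn : f i * P.elt A = f n := by
    have := hAf (n - i) le_rfl
    rwa [List.take_of_length_le hAl.le, Nat.add_sub_cancel' hin] at this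
  have hAg : IsGeodWord P A := by
    rw [IsGeodWord, eq_inv_mul_of_mul_eq hAn, hf i n hin le_rfl, hAl]
  obtain ⟨U, hU, hUg⟩ := exists_geodWord P (x⁻¹ * f n)
  have hUn : x * P.elt U = f n := by rw [hU, mul_inv_cancel_left]
  obtain ⟨t, ht, htU, htmax⟩ : ∃ t, x * P.elt (U.take t) ∈ relatorCycle P g r ∧ t ≤ U.length ∧
      ∀ k, t < k → k ≤ U.length → x * P.elt (U.take k) ∉ relatorCycle P g r :=
    ⟨Nat.findGreatest (fun t => x * P.elt (U.take t) ∈ relatorCycle P g r) U.length,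
      Nat.findGreatest_spec (P := fun t => x * P.elt (U.take t) ∈ relatorCycle P g r)
        (Nat.zero_le _) (by simpa using hx),
      Nat.findGreatest_le _, fun k h1 h2 => Nat.findGreatest_is_greatest h1 h2⟩
  have htlt : t < U.length := htU.lt_of_ne fun h => hn (by
    rwa [h, List.take_length, hUn] at ht)
  have key := wordLength_lt_of_avoid hr hi ht hAg (hUg.drop t)
    (by rw [← List.length_pos_iff]; omega)
    (by rw [← List.length_pos_iff, List.length_drop]; omega)
    (fun k h1 h2 => by rw [hAf k (by omega)]; exact hmax _ (by omega) (by omega))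
    (fun k h1 h2 => by
      rw [List.length_drop] at h2
      rw [mul_assoc, ← elt_append, ← List.take_add]
      exact htmax _ (by omega) (by omega))
    (by rw [hAn, mul_assoc, ← elt_append, List.take_append_drop, hUn])
  rw [List.length_drop, ← wordLength_inv, mul_inv_rev, inv_inv] at key
  have h1 := wordLength_mul_le P (P.elt (U.take t)) ((x * P.elt (U.take t))⁻¹ * f i)
  rw [mul_inv_rev, mul_assoc, mul_inv_cancel_left, ← mul_assoc, ← mul_inv_rev] at h1
  have h2 := wordLength_elt_le P (U.take t)
  rw [List.length_take] at h2
  rw [← hU, hUg]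
  omega

theorem exists_closer {α : Set P.Grp} (hα : IsGeodesic P.gens α) {g : P.Grp} {r : Word S}
    (hr : r ∈ P.rels) (hmeet : (relatorCycle P g r ∩ α).Nonempty) {x y : P.Grp}
    (hx : x ∈ relatorCycle P g r) (hy : y ∈ α) (hy' : y ∉ relatorCycle P g r) :
    ∃ z ∈ relatorCycle P g r ∩ α, wdist P.gens x z < wdist P.gens x y := by
  obtain ⟨I, γ, hI, hγ, rfl⟩ := hα
  obtain ⟨_, hz, m, hm, rfl⟩ := hmeet
  obtain ⟨k, hk, rfl⟩ := hy
  have key : ∀ e : ℤ, |e| = 1 → m + e * (k - m).natAbs = k →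
      (∀ j ≤ (k - m).natAbs, m + e * j ∈ I) →
      ∃ z ∈ relatorCycle P g r ∩ γ '' I, wdist P.gens x z < wdist P.gens x (γ k) := by
    intro e he hek heI
    obtain ⟨i, hi, hir, hlt⟩ := exists_closer_of_nat hr hx (fun j => γ (m + e * j)) (k - m).natAbs
      (fun i j hij hj => by
        have h := hγ _ (heI i (hij.trans hj)) _ (heI j hj)
        rw [wdist, ← Int.cast_sub, ← Int.cast_abs,
          show m + e * i - (m + e * j) = e * (i - j) by ring, abs_mul, he, one_mul,
          abs_sub_comm, abs_of_nonneg (by omega)] at h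
        have h : (wordLength P.gens ((γ (m + e * i))⁻¹ * γ (m + e * j)) : ℤ) = j - i := by
          exact_mod_cast h
        omega)
      (by simpa using hz) (by rwa [hek])
    refine ⟨_, ⟨hir, _, heI i hi, rfl⟩, ?_⟩
    rw [hek] at hlt
    exact Nat.cast_lt.2 hlt
  rcases le_total m k with h | h
  · exact key 1 (by simp) (by omega) fun j hj => hI.out hm hk ⟨by omega, by omega⟩
  · exact key (-1) (by simp) (by omega) fun j hj => hI.out hk hm ⟨by omega, by omega⟩

section SetDist

variable {G : Type*} [Group G] {X : Set G} {x : G} {Y Z : Set G}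

theorem setDist_le {y : G} (hy : y ∈ Y) : setDist X x Y ≤ wdist X x y :=
  csInf_le ⟨0, by rintro _ ⟨z, -, rfl⟩; exact Nat.cast_nonneg _⟩ ⟨y, hy, rfl⟩

theorem exists_wdist_eq_setDist (hY : Y.Nonempty) : ∃ y ∈ Y, wdist X x y = setDist X x Y := by
  let f : G → ℕ := fun y => wordLength X (x⁻¹ * y)
  obtain ⟨hy, hmin⟩ : argminOn f Y hY ∈ Y ∧ ∀ z ∈ Y, f (argminOn f Y hY) ≤ f z :=
    ⟨argminOn_mem f Y hY, fun z hz => argminOn_le f Y hz⟩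
  refine ⟨_, hy, le_antisymm (le_csInf (hY.image _) ?_) (setDist_le hy)⟩
  rintro _ ⟨z, hz, rfl⟩
  exact Nat.cast_le.2 (hmin z hz)

/-- If `Z ⊆ Y` contains all closest points, then closest point projections to `Y` and `Z` agree. -/
theorem proj_eq_of_subset (hZY : Z ⊆ Y) (hY : Y.Nonempty)
    (h : ∀ y ∈ Y, y ∉ Z → ∃ z ∈ Z, wdist X x z < wdist X x y) :
    setDist X x Y = setDist X x Z ∧ proj X Y x = proj X Z x := by
  have hmem : ∀ y ∈ Y, wdist X x y = setDist X x Y → y ∈ Z := by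
    intro y hy heq
    by_contra hyZ
    obtain ⟨z, hz, hlt⟩ := h y hy hyZ
    exact (setDist_le (hZY hz)).not_gt (heq ▸ hlt)
  have hdist : setDist X x Y = setDist X x Z := by
    obtain ⟨y, hy, heq⟩ := exists_wdist_eq_setDist (X := X) (x := x) hY
    have hyZ := hmem y hy heq
    obtain ⟨z, hz, hzeq⟩ := exists_wdist_eq_setDist (X := X) (x := x) ⟨y, hyZ⟩
    exact (hzeq ▸ setDist_le (hZY hz)).antisymm (heq ▸ setDist_le hyZ)
  refine ⟨hdist, Set.ext fun y => ⟨fun hy => ⟨hmem y hy.1 hy.2, hdist ▸ hy.2⟩,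
    fun hy => ⟨hZY hy.1, hdist ▸ hy.2⟩⟩⟩

end SetDist

end GSC

namespace GSC

/-- In a classical C'(1/6) group, for a geodesic `α` and an embedded
relator cycle `Γ₀` meeting `α`, closest point projection of points of `Γ₀` to `α`
agrees with closest point projection to `Γ₀ ∩ α`. -/
theorem statement18 {S : Type} (P : C6Presentation S) (α : Set P.Grp)
    (hα : IsGeodesic P.gens α) (g : P.Grp) (r : Word S) (hr : r ∈ P.rels)
    (hmeet : (relatorCycle P g r ∩ α).Nonempty) :
    ∀ x ∈ relatorCycle P g r,
      setDist P.gens x α = setDist P.gens x (relatorCycle P g r ∩ α) ∧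
      proj P.gens α x = proj P.gens (relatorCycle P g r ∩ α) x := by
  intro x hx
  exact proj_eq_of_subset Set.inter_subset_right (hmeet.mono Set.inter_subset_right)
    fun y hy hy' => exists_closer hα hr hmeet hx hy fun h => hy' ⟨h, hy⟩

end GSC
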